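/- Let Φ₁, Φ₂ : ℂⁿ → ℝ be real-quadratic weights with positive definite Levi matrices L₁, L₂, and assume Φ₁(x) ≤ Φ₂(x) for all x ∈ ℂⁿ. Let μ₁, …, μₙ ∈ (0, 1] be such that the multiset of eigenvalues (with algebraic multiplicity) of 𝐀_{Φ₂}⁻¹𝐀_{Φ₁} equals {μ₁, …, μₙ, μ₁⁻¹, …, μₙ⁻¹}. Then the norm of the embedding ι : H_{Φ₁} → H_{Φ₂} satisfies ‖ι‖ = ((det L₁ / det L₂) · ∏_{j=1}^n μ_j)^{1/4}. -/

import Mathlib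

open MeasureTheory Real Matrix
open scoped ENNReal ComplexOrder

noncomputable section

/-- Bilinear dot product on ℂⁿ. -/
def dotC {n : ℕ} (x y : Fin n → ℂ) : ℂ := ∑ j, x j * y j

/-- The real-quadratic weight Φ(x) = (1/2)(L x·x̄ + Re(P x·x)). -/
def weight {n : ℕ} (L P : Matrix (Fin n) (Fin n) ℂ) (x : Fin n → ℂ) : ℝ :=
  (1 / 2) * ((dotC (L.mulVec x) (star x)).re + (dotC (P.mulVec x) x).re)

/-- Squared H_Φ norm, valued in [0,∞]. -/
def HPhiNormSq {n : ℕ} (Φ : (Fin n → ℂ) → ℝ) (f : (Fin n → ℂ) → ℂ) : ℝ≥0∞ :=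
  ∫⁻ x, ENNReal.ofReal (‖f x‖ ^ 2 * Real.exp (-4 * π * Φ x))

/-- H_Φ norm, valued in [0,∞]. -/
def HPhiNorm {n : ℕ} (Φ : (Fin n → ℂ) → ℝ) (f : (Fin n → ℂ) → ℂ) : ℝ≥0∞ :=
  HPhiNormSq Φ f ^ (1 / 2 : ℝ)

/-- Entrywise complex conjugate of a matrix. -/
def conjM {m : Type*} (M : Matrix m m ℂ) : Matrix m m ℂ := M.map (starRingEnd ℂ)

/-- The matrix 𝐀_Φ associated with the weight with Levi matrix L and pluriharmonic part P. -/
def Amat {n : ℕ} (L P : Matrix (Fin n) (Fin n) ℂ) :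
    Matrix (Fin n ⊕ Fin n) (Fin n ⊕ Fin n) ℂ :=
  Matrix.fromBlocks (-(conjM L⁻¹ * P)) (Complex.I • conjM L⁻¹)
    (Complex.I • (L - conjM (P * L⁻¹) * P)) (-(conjM (P * L⁻¹)))

/-- Norm of the embedding H_{Φ₁} → H_{Φ₂}. -/
def embedNorm {n : ℕ} (Φ₁ Φ₂ : (Fin n → ℂ) → ℝ) : ℝ≥0∞ :=
  ⨆ f : {f : (Fin n → ℂ) → ℂ //
      Differentiable ℂ f ∧ 0 < HPhiNorm Φ₁ f ∧ HPhiNorm Φ₁ f ≠ ⊤},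
    HPhiNorm Φ₂ f.1 / HPhiNorm Φ₁ f.1

/-- The complex symplectic form on ℂ^{2n}. -/
def symp {n : ℕ} (X Y : Fin n ⊕ Fin n → ℂ) : ℂ :=
  ∑ j, X (Sum.inr j) * Y (Sum.inl j) - ∑ j, Y (Sum.inr j) * X (Sum.inl j)

/-- The phase-space shift S_Y. -/
def shiftOp {n : ℕ} (Y : (Fin n → ℂ) × (Fin n → ℂ)) (f : (Fin n → ℂ) → ℂ)
    (x : Fin n → ℂ) : ℂ :=
  Complex.exp (2 * (π : ℂ) * Complex.I * (-(1 / 2) * dotC Y.1 Y.2 + dotC Y.2 x)) * f (x - Y.1)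

/-- The augmented matrix `[[L, conj P], [P, conj L]]` of the weight in the variables
`(x, conj x)`. -/
def augMat {n : ℕ} (L P : Matrix (Fin n) (Fin n) ℂ) :
    Matrix (Fin n ⊕ Fin n) (Fin n ⊕ Fin n) ℂ :=
  Matrix.fromBlocks L (conjM P) P (conjM L)

/-- The augmented vector `(x, conj x)`. -/
def augVec {n : ℕ} (x : Fin n → ℂ) : Fin n ⊕ Fin n → ℂ := Sum.elim x (star x)

section LinearAlgebra

variable {n : ℕ}

lemma conjM_eq_transpose {m : Type*} {L : Matrix m m ℂ} (hL : L.IsHermitian) : conjM L = Lᵀ := by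
  ext i j
  have := congrFun (congrFun hL j) i
  simpa [conjM] using this

lemma conjM_eq_conjTranspose {m : Type*} {P : Matrix m m ℂ} (hP : P.IsSymm) : conjM P = Pᴴ := by
  ext i j
  have := congrFun (congrFun hP i) j
  simp only [conjM, Matrix.map_apply, Matrix.conjTranspose_apply]
  rw [← this]; rfl

lemma conjM_mulVec_star (A : Matrix (Fin n) (Fin n) ℂ) (x : Fin n → ℂ) :
    conjM A *ᵥ star x = star (A *ᵥ x) := by
  ext i
  simp [conjM, Matrix.mulVec, dotProduct]

lemma star_dotProduct_star' {m : Type*} [Fintype m] (x y : m → ℂ) :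
    star x ⬝ᵥ star y = (starRingEnd ℂ) (x ⬝ᵥ y) := by
  simp [dotProduct]

/-- The sesquilinear pairing of augmented vectors is real. -/
lemma augMat_pairing (L P : Matrix (Fin n) (Fin n) ℂ) (x y : Fin n → ℂ) :
    star (augVec x) ⬝ᵥ (augMat L P *ᵥ augVec y) =
      ((2 * ((star x ⬝ᵥ (L *ᵥ y)).re + (x ⬝ᵥ (P *ᵥ y)).re) : ℝ) : ℂ) := by
  have h1 : star (augVec x) = Sum.elim (star x) x := by
    ext i; rcases i with i | i <;> simp [augVec]
  rw [h1, augMat, augVec, Matrix.fromBlocks_mulVec, sumElim_dotProduct_sumElim]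
  simp only [Sum.elim_comp_inl, Sum.elim_comp_inr, conjM_mulVec_star, dotProduct_add]
  rw [star_dotProduct_star']
  have h2 := star_dotProduct_star' (star x) (L *ᵥ y)
  rw [star_star] at h2
  rw [h2]
  apply Complex.ext
  · simp; ring
  · simp

lemma augMat_quadForm (L P : Matrix (Fin n) (Fin n) ℂ) (x : Fin n → ℂ) :
    star (augVec x) ⬝ᵥ (augMat L P *ᵥ augVec x) = ((4 * weight L P x : ℝ) : ℂ) := by
  rw [augMat_pairing]
  congr 1
  have h1 : dotC (L.mulVec x) (star x) = star x ⬝ᵥ (L *ᵥ x) := dotProduct_comm _ _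
  have h2 : dotC (P.mulVec x) x = x ⬝ᵥ (P *ᵥ x) := dotProduct_comm _ _
  rw [weight, h1, h2]
  ring

lemma augMat_isHermitian {L P : Matrix (Fin n) (Fin n) ℂ} (hL : L.IsHermitian) (hP : P.IsSymm) :
    (augMat L P).IsHermitian := by
  apply Matrix.IsHermitian.fromBlocks hL
  · rw [conjM_eq_conjTranspose hP, Matrix.conjTranspose_conjTranspose]
  · rw [conjM_eq_transpose hL]; exact hL.transpose

/-- Every vector of `ℂ²ⁿ` is `augVec x + i augVec y`, and the augmented quadratic form splits. -/
lemma augMat_quadForm_split {L P : Matrix (Fin n) (Fin n) ℂ} (hL : L.IsHermitian)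
    (hP : P.IsSymm) (v : Fin n ⊕ Fin n → ℂ) :
    ∃ x y : Fin n → ℂ, v = augVec x + Complex.I • augVec y ∧
      star v ⬝ᵥ (augMat L P *ᵥ v) = ((4 * (weight L P x + weight L P y) : ℝ) : ℂ) := by
  obtain ⟨x, y, hv⟩ : ∃ x y : Fin n → ℂ, v = augVec x + Complex.I • augVec y := by
    refine ⟨fun i => (v (Sum.inl i) + star (v (Sum.inr i))) / 2,
      fun i => (v (Sum.inl i) - star (v (Sum.inr i))) / (2 * Complex.I), ?_⟩
    ext i
    rcases i with i | i
    · simp [augVec]; field_simp; ring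
    · simp [augVec]; field_simp; ring
  refine ⟨x, y, hv, ?_⟩
  have hsymm : star (augVec y) ⬝ᵥ (augMat L P *ᵥ augVec x) =
      star (augVec x) ⬝ᵥ (augMat L P *ᵥ augVec y) := by
    have h := star_dotProduct_star' (star (augVec x)) (augMat L P *ᵥ augVec y)
    rw [star_star, Matrix.star_mulVec, (augMat_isHermitian hL hP).eq, dotProduct_comm,
      ← Matrix.dotProduct_mulVec] at h
    rw [h, augMat_pairing, Complex.conj_ofReal]
  rw [hv, star_add, star_smul, Matrix.mulVec_add, Matrix.mulVec_smul, dotProduct_add,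
    add_dotProduct, add_dotProduct, dotProduct_smul, dotProduct_smul, smul_dotProduct,
    smul_dotProduct, hsymm, augMat_quadForm, augMat_quadForm]
  simp only [smul_eq_mul, Complex.star_def, Complex.conj_I]
  push_cast
  linear_combination (-(4 : ℂ) * (weight L P y)) * Complex.I_sq

lemma augMat_posSemidef {L P : Matrix (Fin n) (Fin n) ℂ} (hL : L.IsHermitian)
    (hP : P.IsSymm) (h : ∀ x, 0 ≤ weight L P x) : (augMat L P).PosSemidef := by
  refine .of_dotProduct_mulVec_nonneg (augMat_isHermitian hL hP) fun v => ?_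
  obtain ⟨x, y, -, hv⟩ := augMat_quadForm_split hL hP v
  rw [hv, Complex.zero_le_real]
  linarith [h x, h y]

lemma weight_zero_right (L P : Matrix (Fin n) (Fin n) ℂ) : weight L P 0 = 0 := by
  simp [weight, dotC]

lemma augMat_posDef {L P : Matrix (Fin n) (Fin n) ℂ} (hL : L.IsHermitian)
    (hP : P.IsSymm) (h : ∀ x, x ≠ 0 → 0 < weight L P x) : (augMat L P).PosDef := by
  refine .of_dotProduct_mulVec_pos (augMat_isHermitian hL hP) fun v hv0 => ?_
  obtain ⟨x, y, hxy, hv⟩ := augMat_quadForm_split hL hP v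
  rw [hv, Complex.zero_lt_real]
  have h' : ∀ x, 0 ≤ weight L P x := fun x => by
    by_cases hx : x = 0
    · rw [hx, weight_zero_right]
    · exact (h x hx).le
  by_cases hx : x = 0
  · have hy : y ≠ 0 := by
      rintro rfl
      apply hv0
      rw [hxy, hx]
      ext i
      rcases i with i | i <;> simp [augVec]
    linarith [h' x, h y hy]
  · linarith [h x hx, h' y]

lemma weight_pos_of_augMat_posDef {L P : Matrix (Fin n) (Fin n) ℂ} (h : (augMat L P).PosDef)
    (x : Fin n → ℂ) (hx : x ≠ 0) : 0 < weight L P x := by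
  have hx' : augVec x ≠ 0 := fun h0 => hx (by
    ext i
    exact congrFun h0 (Sum.inl i))
  have := h.dotProduct_mulVec_pos hx'
  rw [augMat_quadForm, Complex.zero_lt_real] at this
  linarith

lemma weight_add (L P L' P' : Matrix (Fin n) (Fin n) ℂ) (x : Fin n → ℂ) :
    weight (L + L') (P + P') x = weight L P x + weight L' P' x := by
  simp only [weight, dotC, Matrix.add_mulVec, Pi.add_apply, add_mul, Finset.sum_add_distrib,
    Complex.add_re]
  ring

/-- A positive definite matrix and a Hermitian matrix are simultaneously diagonalizable by
congruence. -/
lemma exists_simultaneous_diagonalization {m : Type*} [Fintype m] [DecidableEq m]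
    {A B : Matrix m m ℂ} (hA : A.PosDef) (hB : B.IsHermitian) :
    ∃ (S : Matrix m m ℂ) (d : m → ℝ), IsUnit S ∧ A = S * Sᴴ ∧
      B = S * diagonal (fun i => (d i : ℂ)) * Sᴴ := by
  obtain ⟨R, hR, hAR⟩ : ∃ R : Matrix m m ℂ, IsUnit R ∧ A = R * Rᴴ := by
    let U : Matrix m m ℂ := hA.1.eigenvectorUnitary
    let D : Matrix m m ℂ := diagonal fun i => ((√(hA.1.eigenvalues i) : ℝ) : ℂ)
    have hAe : A = (U * D) * (U * D)ᴴ := by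
      have h := hA.1.spectral_theorem
      rw [Unitary.conjStarAlgAut_apply] at h
      have hD : D * Dᴴ = diagonal (RCLike.ofReal ∘ hA.1.eigenvalues) := by
        rw [diagonal_conjTranspose, diagonal_mul_diagonal]
        congr 1
        ext i
        simp only [Pi.star_apply, Function.comp, Complex.star_def, Complex.conj_ofReal]
        rw [← Complex.ofReal_mul, Real.mul_self_sqrt (hA.eigenvalues_pos i).le]
        rfl
      rw [conjTranspose_mul, ← mul_assoc, mul_assoc U, hD]
      exact h
    refine ⟨U * D, ?_, hAe⟩
    have := hA.isUnit
    rw [hAe] at this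
    rw [Matrix.isUnit_iff_isUnit_det] at this ⊢
    rw [det_mul] at this
    exact isUnit_of_mul_isUnit_left this
  have hRdet : IsUnit R.det := (Matrix.isUnit_iff_isUnit_det _).1 hR
  have hH : (R⁻¹ * B * (R⁻¹)ᴴ).IsHermitian := isHermitian_mul_mul_conjTranspose _ hB
  let U : Matrix m m ℂ := hH.eigenvectorUnitary
  have hUU : U * Uᴴ = 1 := Unitary.coe_mul_star_self hH.eigenvectorUnitary
  refine ⟨R * U, hH.eigenvalues, ?_, ?_, ?_⟩
  · exact hR.mul (IsUnit.of_mul_eq_one _ hUU)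
  · rw [conjTranspose_mul, ← mul_assoc, mul_assoc R, hUU, mul_one, hAR]
  · have h := hH.spectral_theorem
    rw [Unitary.conjStarAlgAut_apply] at h
    have h' : R⁻¹ * B * (R⁻¹)ᴴ = U * diagonal (fun i => (hH.eigenvalues i : ℂ)) * Uᴴ := h
    have : R * (R⁻¹ * B * (R⁻¹)ᴴ) * Rᴴ = B := by
      have h2 : (R⁻¹)ᴴ * Rᴴ = 1 := by
        rw [← conjTranspose_mul, mul_nonsing_inv _ hRdet, conjTranspose_one]
      rw [mul_assoc R, mul_assoc (R⁻¹ * B), h2, mul_one, ← mul_assoc, mul_nonsing_inv _ hRdet,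
        one_mul]
    refine this.symm.trans ((congrArg (fun X => R * X * Rᴴ) h').trans ?_)
    rw [conjTranspose_mul]
    simp only [mul_assoc]

/-- If `A` and `B - A` are positive definite then so is `A⁻¹ - B⁻¹`. -/
lemma posDef_inv_sub_inv {m : Type*} [Fintype m] [DecidableEq m]
    {A B : Matrix m m ℂ} (hA : A.PosDef) (hAB : (B - A).PosDef) : (A⁻¹ - B⁻¹).PosDef := by
  obtain ⟨S, d, hS, hAS, hBS⟩ := exists_simultaneous_diagonalization hA hAB.1
  have hSd : IsUnit S.det := (Matrix.isUnit_iff_isUnit_det _).1 hS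
  have hSd' : IsUnit (Sᴴ).det := by rw [det_conjTranspose]; exact hSd.star
  have hd : ∀ i, 0 < d i := by
    rw [hBS, ← star_eq_conjTranspose, Matrix.IsUnit.posDef_star_right_conjugate_iff hS,
      posDef_diagonal_iff] at hAB
    intro i
    exact Complex.zero_lt_real.1 (hAB i)
  have hB : B = S * diagonal (fun i => ((1 + d i : ℝ) : ℂ)) * Sᴴ := by
    have : diagonal (fun i => ((1 + d i : ℝ) : ℂ)) = 1 + diagonal (fun i => (d i : ℂ)) := by
      rw [← diagonal_one, diagonal_add]
      simp
    rw [this, mul_add, add_mul, mul_one, ← hAS, ← hBS]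
    abel
  have hdi : (diagonal (fun i => ((1 + d i : ℝ) : ℂ)))⁻¹ =
      diagonal (fun i => (((1 + d i)⁻¹ : ℝ) : ℂ)) := by
    apply Matrix.inv_eq_left_inv
    rw [diagonal_mul_diagonal, ← diagonal_one]
    congr 1
    ext i
    rw [← Complex.ofReal_mul, inv_mul_cancel₀ (by linarith [hd i]), Complex.ofReal_one]
  have key : A⁻¹ - B⁻¹ =
      (S⁻¹)ᴴ * diagonal (fun i => ((1 - (1 + d i)⁻¹ : ℝ) : ℂ)) * S⁻¹ := by
    have : diagonal (fun i => ((1 - (1 + d i)⁻¹ : ℝ) : ℂ)) =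
        1 - diagonal (fun i => (((1 + d i)⁻¹ : ℝ) : ℂ)) := by
      rw [← diagonal_one, diagonal_sub]
      simp
    rw [this, mul_sub, sub_mul, mul_one, hAS, hB, Matrix.mul_inv_rev, Matrix.mul_inv_rev,
      Matrix.mul_inv_rev, hdi, conjTranspose_nonsing_inv, mul_assoc (Sᴴ)⁻¹]
  rw [key]
  have hSi : IsUnit S⁻¹ := by rwa [Matrix.isUnit_nonsing_inv_iff]
  rw [← star_eq_conjTranspose, Matrix.IsUnit.posDef_star_left_conjugate_iff hSi,
    posDef_diagonal_iff]
  intro i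
  rw [Complex.zero_lt_real, sub_pos]
  exact inv_lt_one_of_one_lt₀ (by linarith [hd i])

end LinearAlgebra

section Covariance

variable {n : ℕ}

lemma conjM_mul {m : Type*} [Fintype m] (A B : Matrix m m ℂ) :
    conjM (A * B) = conjM A * conjM B := Matrix.map_mul

lemma conjM_add {m : Type*} (A B : Matrix m m ℂ) : conjM (A + B) = conjM A + conjM B := by
  ext; simp [conjM]

lemma conjM_one {m : Type*} [DecidableEq m] : conjM (1 : Matrix m m ℂ) = 1 := by
  simp [conjM]

lemma conjM_conjM {m : Type*} (A : Matrix m m ℂ) : conjM (conjM A) = A := by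
  ext; simp [conjM]

lemma conjM_inv {m : Type*} [Fintype m] [DecidableEq m] (A : Matrix m m ℂ) :
    conjM A⁻¹ = (conjM A)⁻¹ := by
  have h : ∀ B : Matrix m m ℂ, conjM B = (Bᴴ)ᵀ := fun B => by ext; simp [conjM]
  rw [h, h, conjTranspose_nonsing_inv, transpose_nonsing_inv]

/-- The (rescaled) Hermitian covariance matrix of the Gaussian with the given weight. -/
def covMat (L P : Matrix (Fin n) (Fin n) ℂ) : Matrix (Fin n) (Fin n) ℂ :=
  (augMat L P)⁻¹.toBlocks₁₁

/-- The conjugate of the (rescaled) pseudo-covariance matrix of the Gaussian with the given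
weight. -/
def pseudoCovMat (L P : Matrix (Fin n) (Fin n) ℂ) : Matrix (Fin n) (Fin n) ℂ :=
  (augMat L P)⁻¹.toBlocks₂₁

lemma inv_augMat (L P : Matrix (Fin n) (Fin n) ℂ) :
    (augMat L P)⁻¹ = augMat (covMat L P) (pseudoCovMat L P) := by
  have hreal : ∀ L P : Matrix (Fin n) (Fin n) ℂ, (augMat L P).submatrix (Equiv.sumComm _ _)
      (Equiv.sumComm _ _) = conjM (augMat L P) := fun L P => by
    ext i j
    rcases i with i | i <;> rcases j with j | j <;> simp [augMat, conjM]
  have h : (augMat L P)⁻¹.submatrix (Equiv.sumComm _ _) (Equiv.sumComm _ _) =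
      conjM (augMat L P)⁻¹ := by
    rw [conjM_inv, ← hreal, Matrix.inv_submatrix_equiv]
  ext i j
  rcases i with i | i <;> rcases j with j | j
  · rfl
  · have := congrFun (congrFun h (Sum.inr i)) (Sum.inl j)
    simp only [submatrix_apply, Equiv.sumComm_apply, Sum.swap_inr, Sum.swap_inl] at this
    rw [this]; rfl
  · rfl
  · have := congrFun (congrFun h (Sum.inl i)) (Sum.inl j)
    simp only [submatrix_apply, Equiv.sumComm_apply, Sum.swap_inl] at this
    rw [this]; rfl

lemma covMat_posDef {L P : Matrix (Fin n) (Fin n) ℂ} (h : (augMat L P).PosDef) :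
    (covMat L P).PosDef :=
  h.inv.submatrix Sum.inl_injective

lemma pseudoCovMat_isSymm {L P : Matrix (Fin n) (Fin n) ℂ} (h : (augMat L P).PosDef) :
    (pseudoCovMat L P).IsSymm := by
  have h1 := h.inv.1
  rw [inv_augMat] at h1
  ext i j
  have := congrFun (congrFun h1 (Sum.inl i)) (Sum.inr j)
  simp only [augMat, conjM, conjTranspose_apply, fromBlocks_apply₁₂, fromBlocks_apply₂₁,
    map_apply, Complex.star_def] at this
  exact (starRingEnd ℂ).injective this

lemma augMat_mul (L P L' P' : Matrix (Fin n) (Fin n) ℂ) :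
    augMat L P * augMat L' P' =
      fromBlocks (L * L' + conjM P * P') (L * conjM P' + conjM P * conjM L')
      (P * L' + conjM L * P') (P * conjM P' + conjM L * conjM L') :=
  Matrix.fromBlocks_multiply _ _ _ _ _ _ _ _

lemma cov_relations_left {L P : Matrix (Fin n) (Fin n) ℂ} (h : (augMat L P).PosDef) :
    L * covMat L P + conjM P * pseudoCovMat L P = 1 ∧
      P * covMat L P + conjM L * pseudoCovMat L P = 0 ∧
      P * conjM (pseudoCovMat L P) + conjM L * conjM (covMat L P) = 1 := by
  have h1 : augMat L P * augMat (covMat L P) (pseudoCovMat L P) = 1 := by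
    rw [← inv_augMat, mul_nonsing_inv _ ((isUnit_iff_isUnit_det _).1 h.isUnit)]
  rw [augMat_mul, ← fromBlocks_one, fromBlocks_inj] at h1
  exact ⟨h1.1, h1.2.2.1, h1.2.2.2⟩

lemma cov_relation_right {L P : Matrix (Fin n) (Fin n) ℂ} (h : (augMat L P).PosDef) :
    covMat L P * conjM P + conjM (pseudoCovMat L P) * conjM L = 0 := by
  have h1 : augMat (covMat L P) (pseudoCovMat L P) * augMat L P = 1 := by
    rw [← inv_augMat, nonsing_inv_mul _ ((isUnit_iff_isUnit_det _).1 h.isUnit)]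
  rw [augMat_mul, ← fromBlocks_one, fromBlocks_inj] at h1
  exact h1.2.1

lemma det_augMat_mul_det_covMat {L P : Matrix (Fin n) (Fin n) ℂ} (hL : L.IsHermitian)
    (h : (augMat L P).PosDef) : (augMat L P).det * (covMat L P).det = L.det := by
  obtain ⟨h1, h2, -⟩ := cov_relations_left h
  have h3 : augMat L P * fromBlocks (covMat L P) 0 (pseudoCovMat L P) 1 =
      fromBlocks 1 (conjM P) 0 (conjM L) := by
    rw [augMat, fromBlocks_multiply, h1, h2]
    simp
  have h4 := congrArg Matrix.det h3
  rw [det_mul, det_fromBlocks_zero₁₂, det_fromBlocks_zero₂₁, conjM_eq_transpose hL,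
    det_transpose, det_one, mul_one, one_mul] at h4
  exact h4

/-- The upper triangular block shear used in the factorization of `Amat`. -/
def upperShear (C : Matrix (Fin n) (Fin n) ℂ) : Matrix (Fin n ⊕ Fin n) (Fin n ⊕ Fin n) ℂ :=
  fromBlocks 1 (-(Complex.I • C)) 0 1

/-- The lower triangular block shear implementing multiplication by a Gaussian. -/
def lowerShear (Q : Matrix (Fin n) (Fin n) ℂ) : Matrix (Fin n ⊕ Fin n) (Fin n ⊕ Fin n) ℂ :=
  fromBlocks 1 0 (-(Complex.I • Q)) 1

/-- The antidiagonal block matrix built from a covariance matrix. -/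
def antiDiag (S : Matrix (Fin n) (Fin n) ℂ) : Matrix (Fin n ⊕ Fin n) (Fin n ⊕ Fin n) ℂ :=
  fromBlocks 0 (Complex.I • conjM S) (Complex.I • S⁻¹) 0

lemma isUnit_upperShear (C : Matrix (Fin n) (Fin n) ℂ) : IsUnit (upperShear C) := by
  rw [isUnit_iff_isUnit_det, upperShear, det_fromBlocks_zero₂₁]
  simp

lemma isUnit_lowerShear (Q : Matrix (Fin n) (Fin n) ℂ) : IsUnit (lowerShear Q) := by
  rw [isUnit_iff_isUnit_det, lowerShear, det_fromBlocks_zero₁₂]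
  simp

lemma isUnit_conjM {m : Type*} [Fintype m] [DecidableEq m] {A : Matrix m m ℂ} (h : IsUnit A) :
    IsUnit (conjM A) :=
  h.map (starRingEnd ℂ).mapMatrix

lemma Amat_add (L P Q : Matrix (Fin n) (Fin n) ℂ) :
    Amat L (P + Q) * lowerShear Q = conjM (lowerShear Q) * Amat L P := by
  have h : conjM (lowerShear Q) = fromBlocks 1 0 (Complex.I • conjM Q) 1 := by
    ext i j
    rcases i with i | i <;> rcases j with j | j <;> simp [lowerShear, conjM, Matrix.one_apply]
  rw [h, lowerShear, Amat, Amat, fromBlocks_multiply, fromBlocks_multiply, fromBlocks_inj]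
  simp only [conjM_mul, conjM_add, mul_one, mul_zero, add_zero, zero_add, one_mul, zero_mul,
    mul_neg, neg_mul, Matrix.smul_mul, Matrix.mul_smul, smul_smul, Complex.I_mul_I, mul_add,
    add_mul, neg_smul, one_smul, neg_neg, smul_sub, smul_add, Matrix.mul_assoc]
  refine ⟨?_, ?_, ?_, ?_⟩ <;> abel

lemma Amat_eq {L P : Matrix (Fin n) (Fin n) ℂ} (hL : L.PosDef)
    (h : (augMat L P).PosDef) :
    Amat L P = upperShear (pseudoCovMat L P) * antiDiag (covMat L P) *
      upperShear (conjM (pseudoCovMat L P)) := by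
  obtain ⟨h1, h2, h3⟩ := cov_relations_left h
  have h4 := cov_relation_right h
  have hSd : IsUnit (covMat L P).det := (isUnit_iff_isUnit_det _).1 (covMat_posDef h).isUnit
  have hLd : IsUnit (conjM L).det := (isUnit_iff_isUnit_det _).1 (isUnit_conjM hL.isUnit)
  unfold Amat
  rw [conjM_mul, conjM_inv, upperShear, upperShear, antiDiag]
  generalize covMat L P = S at *
  generalize pseudoCovMat L P = D at *
  generalize conjM L = Lc at *
  generalize conjM P = Pc at *
  generalize conjM D = Dc at *
  generalize conjM S = Sc at *
  have e1 : Lc⁻¹ * P = -(D * S⁻¹) := by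
    have : P = -(Lc * D * S⁻¹) := by
      rw [← neg_mul, ← eq_neg_of_add_eq_zero_left h2, mul_nonsing_inv_cancel_right _ _ hSd]
    rw [this, mul_assoc, mul_neg, nonsing_inv_mul_cancel_left _ _ hLd]
  have e2 : Pc * Lc⁻¹ = -(S⁻¹ * Dc) := by
    have : Pc = -(S⁻¹ * (Dc * Lc)) := by
      rw [← mul_neg, ← eq_neg_of_add_eq_zero_left h4, nonsing_inv_mul_cancel_left _ _ hSd]
    rw [this, neg_mul, mul_assoc, mul_nonsing_inv_cancel_right _ _ hLd]
  have e3 : L - Pc * Lc⁻¹ * P = S⁻¹ := by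
    rw [mul_assoc, e1, mul_neg, sub_neg_eq_add, ← mul_assoc]
    calc L + Pc * D * S⁻¹ = (L * S + Pc * D) * S⁻¹ := by
          rw [add_mul, mul_nonsing_inv_cancel_right _ _ hSd]
      _ = S⁻¹ := by rw [h1, one_mul]
  have e4 : Lc⁻¹ = Sc - D * S⁻¹ * Dc := by
    calc Lc⁻¹ = Lc⁻¹ * (P * Dc + Lc * Sc) := by rw [h3, mul_one]
      _ = Sc - D * S⁻¹ * Dc := by
        rw [mul_add, nonsing_inv_mul_cancel_left _ _ hLd, ← mul_assoc, e1, neg_mul]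
        abel
  rw [e3, e1, e2, e4]
  rw [fromBlocks_multiply, fromBlocks_multiply, fromBlocks_inj]
  simp only [mul_one, mul_zero, add_zero, zero_add, one_mul, zero_mul,
    mul_neg, neg_mul, Matrix.smul_mul, Matrix.mul_smul, smul_smul, Complex.I_mul_I,
    neg_smul, one_smul, neg_neg, smul_sub, Matrix.mul_assoc]
  refine ⟨trivial, ?_, trivial, trivial⟩
  abel

lemma antiDiag_inv_mul {S₁ S₂ : Matrix (Fin n) (Fin n) ℂ} (h₂ : IsUnit S₂) :
    IsUnit (antiDiag S₂) ∧
      (antiDiag S₂)⁻¹ * antiDiag S₁ = fromBlocks (S₂ * S₁⁻¹) 0 0 ((conjM S₂)⁻¹ * conjM S₁) := by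
  have hd₂ : IsUnit S₂.det := (isUnit_iff_isUnit_det _).1 h₂
  have hd₂' : IsUnit (conjM S₂).det := (isUnit_iff_isUnit_det _).1 (isUnit_conjM h₂)
  have hmul :
      fromBlocks 0 (-(Complex.I • S₂)) (-(Complex.I • (conjM S₂)⁻¹)) 0 * antiDiag S₂ = 1 := by
    rw [antiDiag, fromBlocks_multiply, ← fromBlocks_one, fromBlocks_inj]
    simp [smul_smul, mul_nonsing_inv _ hd₂, nonsing_inv_mul _ hd₂']
  refine ⟨.of_mul_eq_one_right _ hmul, ?_⟩
  rw [Matrix.inv_eq_left_inv hmul, antiDiag, fromBlocks_multiply, fromBlocks_inj]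
  simp [smul_smul]

lemma isUnit_Amat {L P : Matrix (Fin n) (Fin n) ℂ} (hL : L.PosDef) :
    IsUnit (Amat L P) := by
  have h0 : IsUnit (Amat L 0) := by
    have : (augMat L 0).PosDef := by
      apply augMat_posDef hL.1 Matrix.isSymm_zero
      intro x hx
      have := hL.re_dotProduct_pos hx
      have h1 : dotC (L.mulVec x) (star x) = star x ⬝ᵥ (L *ᵥ x) := dotProduct_comm _ _
      simp only [weight, h1, zero_mulVec]
      simpa [dotC] using this
    rw [Amat_eq hL this]
    exact ((isUnit_upperShear _).mul
      (antiDiag_inv_mul (S₁ := 0) (covMat_posDef this).isUnit).1).mul (isUnit_upperShear _)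
  have h := Amat_add L 0 P
  rw [zero_add] at h
  have h2 := (isUnit_conjM (isUnit_lowerShear P)).mul h0
  rw [← h] at h2
  exact isUnit_of_mul_isUnit_left h2

lemma charpoly_inv_mul_of_factor {m : Type*} [Fintype m] [DecidableEq m]
    {X Y B₁ B₂ : Matrix m m ℂ} (hX : IsUnit X) (hY : IsUnit Y) :
    ((X * (B₂ * Y))⁻¹ * (X * (B₁ * Y))).charpoly = (B₂⁻¹ * B₁).charpoly := by
  have e : (X * (B₂ * Y))⁻¹ * (X * (B₁ * Y)) = Y⁻¹ * (B₂⁻¹ * B₁) * Y := by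
    rw [Matrix.mul_inv_rev, Matrix.mul_inv_rev, mul_assoc, nonsing_inv_mul_cancel_left _ _
      ((isUnit_iff_isUnit_det _).1 hX)]
    simp only [mul_assoc]
  have hYu := Matrix.charpoly_units_conj' hY.unit (B₂⁻¹ * B₁)
  rw [IsUnit.unit_spec] at hYu
  rw [e, hYu]

/-- When the pseudo-covariances agree, the spectrum of `𝐀₂⁻¹ 𝐀₁` is given by the relative spectrum
of the covariance matrices. -/
lemma charpoly_Amat_inv_mul {L₁ P₁ L₂ P₂ Q : Matrix (Fin n) (Fin n) ℂ}
    (hL₁ : L₁.PosDef) (hL₂ : L₂.PosDef)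
    (h₁ : (augMat L₁ (P₁ + Q)).PosDef) (h₂ : (augMat L₂ (P₂ + Q)).PosDef)
    (hD : pseudoCovMat L₁ (P₁ + Q) = pseudoCovMat L₂ (P₂ + Q)) :
    ((Amat L₂ P₂)⁻¹ * Amat L₁ P₁).charpoly =
      (covMat L₂ (P₂ + Q) * (covMat L₁ (P₁ + Q))⁻¹).charpoly *
        (covMat L₁ (P₁ + Q) * (covMat L₂ (P₂ + Q))⁻¹).charpoly := by
  have hS₁ := covMat_posDef h₁
  have hS₂ := covMat_posDef h₂
  have hA : ∀ {L P : Matrix (Fin n) (Fin n) ℂ}, L.PosDef → (augMat L (P + Q)).PosDef →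
      Amat L P = ((conjM (lowerShear Q))⁻¹ * upperShear (pseudoCovMat L (P + Q))) *
        (antiDiag (covMat L (P + Q)) *
          (upperShear (conjM (pseudoCovMat L (P + Q))) * lowerShear Q)) := by
    intro L P hL h
    have hu := (isUnit_iff_isUnit_det _).1 (isUnit_conjM (isUnit_lowerShear Q))
    have := Amat_add L P Q
    rw [← nonsing_inv_mul_cancel_left (conjM (lowerShear Q)) (Amat L P) hu, ← this, Amat_eq hL h]
    simp only [mul_assoc]
  obtain ⟨-, hB⟩ := antiDiag_inv_mul (S₁ := covMat L₁ (P₁ + Q)) hS₂.isUnit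
  have hT : ((conjM (covMat L₂ (P₂ + Q)))⁻¹ * conjM (covMat L₁ (P₁ + Q))).charpoly =
      (covMat L₁ (P₁ + Q) * (covMat L₂ (P₂ + Q))⁻¹).charpoly := by
    rw [conjM_eq_transpose hS₁.1, conjM_eq_transpose hS₂.1, ← transpose_nonsing_inv,
      ← transpose_mul, charpoly_transpose]
  have hX : IsUnit ((conjM (lowerShear Q))⁻¹ * upperShear (pseudoCovMat L₂ (P₂ + Q))) := by
    refine IsUnit.mul ?_ (isUnit_upperShear _)
    rw [Matrix.isUnit_nonsing_inv_iff]
    exact isUnit_conjM (isUnit_lowerShear Q)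
  rw [hA hL₁ h₁, hA hL₂ h₂, hD, charpoly_inv_mul_of_factor hX
    ((isUnit_upperShear _).mul (isUnit_lowerShear Q)), hB, charpoly_fromBlocks_zero₁₂, hT]

/-- Strict monotonicity of covariances, with explicit relative spectrum. -/
lemma exists_relative_spectrum {A B : Matrix (Fin n) (Fin n) ℂ} (hA : A.PosDef) (hB : B.PosDef)
    (hAB : (A - B).PosDef) :
    ∃ ν : Fin n → ℝ, (∀ j, ν j ∈ Set.Ioc (0 : ℝ) 1) ∧ B.det = A.det * ((∏ j, ν j : ℝ) : ℂ) ∧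
      (B * A⁻¹).charpoly = ∏ j, (Polynomial.X - Polynomial.C (ν j : ℂ)) ∧
      (A * B⁻¹).charpoly = ∏ j, (Polynomial.X - Polynomial.C ((ν j : ℂ)⁻¹)) := by
  obtain ⟨S, d, hS, hAS, hBS⟩ := exists_simultaneous_diagonalization hA hB.1
  have hSd : IsUnit S.det := (Matrix.isUnit_iff_isUnit_det _).1 hS
  have hSd' : IsUnit (Sᴴ).det := by rw [det_conjTranspose]; exact hSd.star
  have hd : ∀ i, 0 < d i := by
    rw [hBS, ← star_eq_conjTranspose, Matrix.IsUnit.posDef_star_right_conjugate_iff hS,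
      posDef_diagonal_iff] at hB
    exact fun i => Complex.zero_lt_real.1 (hB i)
  have hd1 : ∀ i, d i < 1 := by
    have : A - B = S * diagonal (fun i => ((1 - d i : ℝ) : ℂ)) * Sᴴ := by
      have : diagonal (fun i => ((1 - d i : ℝ) : ℂ)) = 1 - diagonal (fun i => (d i : ℂ)) := by
        rw [← diagonal_one, diagonal_sub]
        simp
      rw [this, mul_sub, sub_mul, mul_one, ← hAS, ← hBS]
    rw [this, ← star_eq_conjTranspose, Matrix.IsUnit.posDef_star_right_conjugate_iff hS,
      posDef_diagonal_iff] at hAB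
    intro i
    have := Complex.zero_lt_real.1 (hAB i)
    linarith
  have hconj : ∀ D : Matrix (Fin n) (Fin n) ℂ, (S * D * S⁻¹).charpoly = D.charpoly := fun D => by
    have := Matrix.charpoly_units_conj hS.unit D
    rwa [IsUnit.unit_spec] at this
  have hdi : (diagonal (fun i => (d i : ℂ)))⁻¹ = diagonal (fun i => (d i : ℂ)⁻¹) := by
    apply Matrix.inv_eq_left_inv
    rw [diagonal_mul_diagonal, ← diagonal_one]
    congr 1
    ext i
    exact inv_mul_cancel₀ (by exact_mod_cast (hd i).ne')
  refine ⟨d, fun j => ⟨hd j, (hd1 j).le⟩, ?_, ?_, ?_⟩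
  · rw [hBS, hAS, det_mul, det_mul, det_mul, det_diagonal]
    push_cast
    ring
  · rw [← charpoly_diagonal, ← hconj (diagonal _), hAS, Matrix.mul_inv_rev]
    congr 1
    rw [hBS, mul_assoc _ Sᴴ, mul_nonsing_inv_cancel_left _ _ hSd']
  · rw [← charpoly_diagonal, ← hconj (diagonal _), hAS, hBS, Matrix.mul_inv_rev,
      Matrix.mul_inv_rev, hdi]
    congr 1
    rw [mul_assoc S, mul_nonsing_inv_cancel_left _ _ hSd', mul_assoc]

end Covariance

section CriticalPoint

variable {n : ℕ}

lemma hasDerivAt_det_add_smul {m : Type*} [Fintype m] [DecidableEq m] {M E : Matrix m m ℂ}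
    (hM : M.PosDef) :
    HasDerivAt (fun t : ℝ => (M + t • E).det.re) (M.det.re * (M⁻¹ * E).trace.re) 0 := by
  have hu : IsUnit M.det := (isUnit_iff_isUnit_det _).1 hM.isUnit
  have him : M.det.im = 0 := (Complex.lt_def.1 hM.det_pos).2.symm
  let q : Polynomial ℂ := (det (1 + (Polynomial.X : Polynomial ℂ) •
    (M⁻¹ * E).map Polynomial.C)).divX.divX
  have hdet : ∀ t : ℝ, (M + t • E).det =
      M.det * (1 + (M⁻¹ * E).trace * t + q.eval (t : ℂ) * (t : ℂ) ^ 2) := fun t => by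
    have : M + t • E = M * (1 + (t : ℂ) • (M⁻¹ * E)) := by
      rw [mul_add, mul_one, Matrix.mul_smul, mul_nonsing_inv_cancel_left _ _ hu]
      rfl
    rw [this, det_mul, det_one_add_smul]
  have h1 : HasDerivAt (fun z : ℂ =>
      M.det * (1 + (M⁻¹ * E).trace * z + q.eval z * z ^ 2)) (M.det * (M⁻¹ * E).trace)
      ((0 : ℝ) : ℂ) := by
    have h2 := (((hasDerivAt_id (0 : ℂ)).const_mul (M⁻¹ * E).trace).const_add 1).add
      ((q.hasDerivAt 0).mul ((hasDerivAt_id (0 : ℂ)).pow 2))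
    have h3 := h2.const_mul M.det
    simp only [id, mul_one, mul_zero, Nat.cast_ofNat, add_zero, Nat.add_one_sub_one,
      pow_one] at h3
    simpa using h3
  have h4 := h1.real_of_complex
  convert h4 using 1
  · ext t
    rw [hdet]
  · rw [Complex.mul_re, him]
    ring

lemma augMat_add_smul (L P E : Matrix (Fin n) (Fin n) ℂ) (t : ℝ) :
    augMat L (P + t • E) = augMat L P + t • augMat 0 E := by
  ext i j
  rcases i with i | i <;> rcases j with j | j <;> simp [augMat, conjM]

lemma continuous_det_augMat (L P : Matrix (Fin n) (Fin n) ℂ) :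
    Continuous fun Q => (augMat L (P + Q)).det.re := by
  refine Complex.continuous_re.comp (Continuous.matrix_det ?_)
  refine Continuous.matrix_fromBlocks continuous_const ?_ (by fun_prop) continuous_const
  exact Continuous.matrix_map (by fun_prop) Complex.continuous_conj

lemma continuous_weight_right (L P : Matrix (Fin n) (Fin n) ℂ) (x : Fin n → ℂ) :
    Continuous fun Q => weight L (P + Q) x := by
  unfold weight dotC mulVec dotProduct
  fun_prop

lemma trace_inv_augMat_mul {L P E : Matrix (Fin n) (Fin n) ℂ} :
    ((augMat L P)⁻¹ * augMat 0 E).trace.re = 2 * (conjM (pseudoCovMat L P) * E).trace.re := by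
  have hfb : ∀ A B C D : Matrix (Fin n) (Fin n) ℂ,
      (fromBlocks A B C D).trace = A.trace + D.trace := fun A B C D => by
    simp [Matrix.trace, Fintype.sum_sum_type]
  rw [inv_augMat, augMat_mul, hfb]
  have : pseudoCovMat L P * conjM E = conjM (conjM (pseudoCovMat L P) * E) := by
    rw [conjM_mul, conjM_conjM]
  have h0 : conjM (0 : Matrix (Fin n) (Fin n) ℂ) = 0 := by ext; simp [conjM]
  have htr : ∀ A : Matrix (Fin n) (Fin n) ℂ, (conjM A).trace.re = A.trace.re := fun A => by
    simp [conjM, Matrix.trace]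
  rw [mul_zero, zero_add, h0, mul_zero, add_zero, this, Complex.add_re, htr]
  ring

/-- The augmented matrix stays positive semidefinite under small perturbations of `P`. -/
lemma eventually_weight_nonneg {L P E : Matrix (Fin n) (Fin n) ℂ} (hE : E.IsSymm)
    (h : (augMat L P).PosDef) :
    ∀ᶠ t : ℝ in nhds 0, ∀ x, 0 ≤ weight L (P + t • E) x := by
  obtain ⟨S, d, hS, hAS, hBS⟩ := exists_simultaneous_diagonalization h
    (augMat_isHermitian Matrix.isHermitian_zero hE)
  have hev : ∀ᶠ t : ℝ in nhds 0, ∀ i, 0 ≤ 1 + t * d i := by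
    rw [Filter.eventually_all]
    intro i
    have : Filter.Tendsto (fun t : ℝ => 1 + t * d i) (nhds 0) (nhds (1 + 0 * d i)) :=
      (by fun_prop : Continuous fun t : ℝ => 1 + t * d i).tendsto 0
    rw [zero_mul, add_zero] at this
    exact (this.eventually (lt_mem_nhds one_pos)).mono fun t ht => ht.le
  filter_upwards [hev] with t ht x
  have hps : (augMat L (P + t • E)).PosSemidef := by
    have : augMat L (P + t • E) =
        S * diagonal (fun i => ((1 + t * d i : ℝ) : ℂ)) * Sᴴ := by
      have hdg : diagonal (fun i => ((1 + t * d i : ℝ) : ℂ)) =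
          1 + t • diagonal (fun i => (d i : ℂ)) := by
        rw [← diagonal_one, ← diagonal_smul, diagonal_add]
        congr 1
        ext i
        simp
      rw [hdg, mul_add, add_mul, mul_one, ← hAS, Matrix.mul_smul, Matrix.smul_mul, ← hBS,
        augMat_add_smul]
    rw [this]
    refine PosSemidef.mul_mul_conjTranspose_same ?_ S
    rw [posSemidef_diagonal_iff]
    exact fun i => Complex.zero_le_real.2 (ht i)
  have := hps.dotProduct_mulVec_nonneg (augVec x)
  rw [augMat_quadForm, Complex.zero_le_real] at this
  linarith

lemma isCompact_nonneg_weights {L P : Matrix (Fin n) (Fin n) ℂ} (hL : L.IsHermitian)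
    (hP : P.IsSymm) :
    IsCompact {Q : Matrix (Fin n) (Fin n) ℂ | Q.IsSymm ∧ ∀ x, 0 ≤ weight L (P + Q) x} := by
  let B : Set (Fin n → Fin n → ℂ) := Set.univ.pi fun i => Set.univ.pi fun j =>
    Metric.closedBall (-(P i j)) (√((L i i).re * (L j j).re))
  have hB : IsCompact B := isCompact_univ_pi fun i => isCompact_univ_pi fun j =>
    isCompact_closedBall _ _
  refine IsCompact.of_isClosed_subset (s := B) hB ?_ ?_
  · have : T2Space (Matrix (Fin n) (Fin n) ℂ) := inferInstanceAs (T2Space (Fin n → Fin n → ℂ))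
    rw [Set.ofPred_and]
    refine IsClosed.inter (isClosed_eq (Continuous.matrix_transpose continuous_id)
      continuous_id) ?_
    rw [Set.ofPred_forall]
    exact isClosed_iInter fun x => isClosed_le continuous_const (continuous_weight_right L P x)
  · intro (Q : Matrix (Fin n) (Fin n) ℂ) ⟨hQ, hw⟩
    refine Set.mem_univ_pi.2 fun i => Set.mem_univ_pi.2 fun j => ?_
    have hps := augMat_posSemidef hL (hP.add hQ) hw
    have hd := (hps.submatrix ![Sum.inr i, Sum.inl j]).det_nonneg
    have hLi : ∀ i, (starRingEnd ℂ) (L i i) = L i i := fun i => congrFun (congrFun hL i) i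
    have hLr : ∀ i, L i i = ((L i i).re : ℂ) := fun i => (Complex.conj_eq_iff_re.1 (hLi i)).symm
    rw [det_fin_two] at hd
    simp only [augMat, conjM, submatrix_apply, cons_val_zero, cons_val_one,
      fromBlocks_apply₁₁, fromBlocks_apply₁₂, fromBlocks_apply₂₁, fromBlocks_apply₂₂, map_apply,
      hLi] at hd
    have hPQ : (P + Q) j i = (P + Q) i j := congrFun (congrFun (hP.add hQ) i) j
    rw [hPQ, Complex.mul_conj, hLr i, hLr j, ← Complex.ofReal_mul, ← Complex.ofReal_sub,
      Complex.zero_le_real, Complex.normSq_eq_norm_sq] at hd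
    rw [mem_closedBall_iff_norm, sub_neg_eq_add, add_comm]
    exact Real.le_sqrt_of_sq_le (by simpa using hd)

/-- Among the Gaussians, one maximizes the norm ratio; there the pseudo-covariances agree. -/
lemma exists_pseudoCovMat_eq {L₁ P₁ L₂ P₂ : Matrix (Fin n) (Fin n) ℂ}
    (hL₁ : L₁.PosDef) (hL₂ : L₂.PosDef) (hP₁ : P₁.IsSymm) (hP₂ : P₂.IsSymm)
    (hlt : ∀ x, x ≠ 0 → weight L₁ P₁ x < weight L₂ P₂ x) :
    ∃ Q : Matrix (Fin n) (Fin n) ℂ, Q.IsSymm ∧ (augMat L₁ (P₁ + Q)).PosDef ∧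
      (augMat L₂ (P₂ + Q)).PosDef ∧
      pseudoCovMat L₁ (P₁ + Q) = pseudoCovMat L₂ (P₂ + Q) := by
  set K := {Q : Matrix (Fin n) (Fin n) ℂ | Q.IsSymm ∧ ∀ x, 0 ≤ weight L₁ (P₁ + Q) x} with hK
  have hcomp : IsCompact K := isCompact_nonneg_weights hL₁.1 hP₁
  have hshift : ∀ (L P Q : Matrix (Fin n) (Fin n) ℂ) (x : Fin n → ℂ),
      weight L (P + Q) x = weight L P x + weight 0 Q x := fun L P Q x => by
    rw [← weight_add, add_zero]
  have hM₂ : ∀ Q ∈ K, (augMat L₂ (P₂ + Q)).PosDef := by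
    rintro Q ⟨hQ, hw⟩
    refine augMat_posDef hL₂.1 (hP₂.add hQ) fun x hx => ?_
    have h1 := hw x
    have h2 := hlt x hx
    rw [hshift] at h1 ⊢
    linarith
  let F : Matrix (Fin n) (Fin n) ℂ → ℝ := fun Q =>
    (augMat L₁ (P₁ + Q)).det.re / (augMat L₂ (P₂ + Q)).det.re
  have hdet_pos : ∀ {M : Matrix (Fin n ⊕ Fin n) (Fin n ⊕ Fin n) ℂ}, M.PosDef → 0 < M.det.re :=
    fun hM => (Complex.lt_def.1 hM.det_pos).1
  have hFc : ContinuousOn F K := (continuous_det_augMat L₁ P₁).continuousOn.div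
    (continuous_det_augMat L₂ P₂).continuousOn fun Q hQ => (hdet_pos (hM₂ Q hQ)).ne'
  have h0 : ∀ x, x ≠ 0 → 0 < weight L₁ (P₁ + -P₁) x := fun x hx => by
    have := hL₁.re_dotProduct_pos hx
    have h1 : dotC (L₁.mulVec x) (star x) = star x ⬝ᵥ (L₁ *ᵥ x) := dotProduct_comm _ _
    simp only [weight, h1, add_neg_cancel, zero_mulVec]
    simpa [dotC] using this
  have hmem : -P₁ ∈ K := by
    refine ⟨hP₁.neg, fun x => ?_⟩
    by_cases hx : x = 0
    · rw [hx, weight_zero_right]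
    · exact (h0 x hx).le
  obtain ⟨Q, hQK, hmax⟩ := hcomp.exists_isMaxOn ⟨_, hmem⟩ hFc
  have hQs : Q.IsSymm := hQK.1
  have hF0 : 0 < F (-P₁) := div_pos
    (hdet_pos (augMat_posDef hL₁.1 (hP₁.add hP₁.neg) h0)) (hdet_pos (hM₂ _ hmem))
  have hFQ : 0 < F Q := hF0.trans_le (hmax hmem)
  have hps := augMat_posSemidef hL₁.1 (hP₁.add hQs) hQK.2
  have hM₂Q := hM₂ Q hQK
  have hM₁Q : (augMat L₁ (P₁ + Q)).PosDef := by
    refine hps.posDef_iff_isUnit.2 ?_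
    rw [isUnit_iff_isUnit_det, isUnit_iff_ne_zero]
    intro hz
    simp only [F, hz, Complex.zero_re, zero_div, lt_irrefl] at hFQ
  refine ⟨Q, hQs, hM₁Q, hM₂Q, ?_⟩
  set E := pseudoCovMat L₁ (P₁ + Q) - pseudoCovMat L₂ (P₂ + Q) with hE
  have hEs : E.IsSymm := (pseudoCovMat_isSymm hM₁Q).sub (pseudoCovMat_isSymm hM₂Q)
  have hloc : IsLocalMax (fun t : ℝ => F (Q + t • E)) 0 := by
    filter_upwards [eventually_weight_nonneg hEs hM₁Q] with t ht
    have : Q + t • E ∈ K := ⟨hQs.add (hEs.smul t), fun x => by rw [← add_assoc]; exact ht x⟩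
    simpa using hmax this
  have hder : ∀ L P : Matrix (Fin n) (Fin n) ℂ, (augMat L (P + Q)).PosDef →
      HasDerivAt (fun t : ℝ => (augMat L (P + (Q + t • E))).det.re)
        ((augMat L (P + Q)).det.re * (2 * (conjM (pseudoCovMat L (P + Q)) * E).trace.re)) 0 := by
    intro L P h
    have := hasDerivAt_det_add_smul (E := augMat 0 E) h
    rw [trace_inv_augMat_mul] at this
    convert this using 3 with t
    rw [← add_assoc, augMat_add_smul]
  have hdiv := (hder L₁ P₁ hM₁Q).div (hder L₂ P₂ hM₂Q) (by simpa using (hdet_pos hM₂Q).ne')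
  have hzero := hloc.hasDerivAt_eq_zero hdiv
  simp only [zero_smul, add_zero] at hzero
  have hp₁ := hdet_pos hM₁Q
  have hp₂ := hdet_pos hM₂Q
  rw [div_eq_zero_iff, or_iff_left (by positivity)] at hzero
  have htr : (conjM E * E).trace.re = 0 := by
    have hsub : conjM E = conjM (pseudoCovMat L₁ (P₁ + Q)) - conjM (pseudoCovMat L₂ (P₂ + Q)) := by
      ext; simp [conjM, E]
    rw [hsub, sub_mul, trace_sub, Complex.sub_re]
    have : ((augMat L₁ (P₁ + Q)).det.re * (augMat L₂ (P₂ + Q)).det.re) *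
      ((conjM (pseudoCovMat L₁ (P₁ + Q)) * E).trace.re -
        (conjM (pseudoCovMat L₂ (P₂ + Q)) * E).trace.re) = 0 := by linear_combination hzero / 2
    exact (mul_eq_zero.1 this).resolve_left (by positivity)
  rw [conjM_eq_conjTranspose hEs] at htr
  have hnn := (posSemidef_conjTranspose_mul_self E).trace_nonneg
  have hz : (Eᴴ * E).trace = 0 :=
    Complex.ext htr (Complex.le_def.1 hnn).2.symm
  exact sub_eq_zero.1 (trace_conjTranspose_mul_self_eq_zero_iff.1 hz)

end CriticalPoint

section GaussianIntegral

variable {n : ℕ}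

open scoped MatrixOrder Matrix.Norms.L2Operator in
lemma exists_isUnit_transpose_mul_self {m : Type*} [Fintype m] [DecidableEq m]
    {G : Matrix m m ℝ} (hG : G.PosDef) : ∃ B : Matrix m m ℝ, IsUnit B ∧ G = Bᵀ * B := by
  obtain ⟨y, hy, h⟩ := CStarAlgebra.isStrictlyPositive_iff_eq_star_mul_self.mp
    hG.isStrictlyPositive
  exact ⟨y, hy, h⟩

/-- The Gaussian integral of a real positive definite quadratic form, up to normalization. -/
lemma lintegral_exp_neg_quadForm {m : Type*} [Fintype m] [DecidableEq m]
    {G : Matrix m m ℝ} (hG : G.PosDef) :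
    ∫⁻ y : m → ℝ, ENNReal.ofReal (rexp (-π * (y ⬝ᵥ (G *ᵥ y)))) =
      ENNReal.ofReal (√G.det)⁻¹ *
        ∫⁻ y : m → ℝ, ENNReal.ofReal (rexp (-π * (y ⬝ᵥ y))) := by
  obtain ⟨B, hB, rfl⟩ := exists_isUnit_transpose_mul_self hG
  have hdet : B.det ≠ 0 := ((isUnit_iff_isUnit_det _).1 hB).ne_zero
  have hmap := Real.map_matrix_volume_pi_eq_smul_volume_pi hdet
  have hq : ∀ y : m → ℝ, y ⬝ᵥ ((Bᵀ * B) *ᵥ y) = toLin' B y ⬝ᵥ toLin' B y := fun y => by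
    rw [toLin'_apply, ← mulVec_mulVec, dotProduct_mulVec, vecMul_transpose]
  have hmeas : Measurable fun y : m → ℝ => ENNReal.ofReal (rexp (-π * (y ⬝ᵥ y))) := by
    unfold dotProduct
    fun_prop
  simp only [hq]
  rw [← lintegral_map hmeas (LinearMap.continuous_of_finiteDimensional _).measurable, hmap,
    lintegral_smul_measure, det_mul, det_transpose, Real.sqrt_mul_self_eq_abs, abs_inv, smul_eq_mul]

lemma lintegral_exp_neg_dotProduct_self_ne_top {m : Type*} [Fintype m] :
    ∫⁻ y : m → ℝ, ENNReal.ofReal (rexp (-π * (y ⬝ᵥ y))) ≠ ⊤ := by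
  have h : Integrable fun y : m → ℝ => ∏ i, rexp (-π * (y i) ^ 2) :=
    Integrable.fintype_prod (f := fun _ x => rexp (-π * x ^ 2))
      fun _ => integrable_exp_neg_mul_sq pi_pos
  have hsum := h.lintegral_lt_top.ne
  simpa only [← Real.exp_sum, ← Finset.mul_sum, dotProduct, sq] using hsum

/-- Real coordinates on `ℂⁿ`. -/
def realCoord (n : ℕ) : (Fin n ⊕ Fin n → ℝ) ≃ₗ[ℝ] (Fin n → ℂ) where
  toFun y j := ⟨y (Sum.inl j), y (Sum.inr j)⟩
  invFun x := Sum.elim (fun j => (x j).re) (fun j => (x j).im)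
  map_add' y z := funext fun j => Complex.ext (by simp) (by simp)
  map_smul' t y := funext fun j => Complex.ext (by simp) (by simp)
  left_inv y := by ext (j | j) <;> simp
  right_inv x := funext fun j => Complex.ext (by simp) (by simp)

lemma exists_lintegral_realCoord (n : ℕ) : ∃ c : ℝ≥0∞, c ≠ 0 ∧ c ≠ ⊤ ∧
    ∀ g : (Fin n → ℂ) → ℝ≥0∞, Measurable g → ∫⁻ x, g x = c * ∫⁻ y, g (realCoord n y) := by
  let e := (realCoord n).toContinuousLinearEquiv
  have : (Measure.map e volume).IsAddHaarMeasure := e.isAddHaarMeasure_map _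
  have h := Measure.isAddLeftInvariant_eq_smul (volume : Measure (Fin n → ℂ))
    (Measure.map e volume)
  refine ⟨Measure.addHaarScalarFactor volume (Measure.map e volume),
    ENNReal.coe_ne_zero.2 (Measure.addHaarScalarFactor_pos_of_isAddHaarMeasure _ _).ne',
    ENNReal.coe_ne_top, fun g hg => ?_⟩
  conv_lhs => rw [h]
  rw [lintegral_smul_measure, lintegral_map hg e.continuous.measurable]
  rfl

/-- The matrix expressing the augmented vector in real coordinates. -/
def augCoord (n : ℕ) : Matrix (Fin n ⊕ Fin n) (Fin n ⊕ Fin n) ℂ :=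
  fromBlocks 1 (Complex.I • 1) 1 (-Complex.I • 1)

lemma augCoord_mulVec (n : ℕ) (y : Fin n ⊕ Fin n → ℝ) :
    augCoord n *ᵥ (fun i => (y i : ℂ)) = augVec (realCoord n y) := by
  rw [augCoord, fromBlocks_mulVec, augVec]
  congr 1 <;> ext j <;> apply Complex.ext <;> simp [realCoord, smul_mulVec, neg_mulVec]

/-- The Gram matrix of the weight in real coordinates. -/
lemma exists_real_gram (L P : Matrix (Fin n) (Fin n) ℂ) :
    ∃ G : Matrix (Fin n ⊕ Fin n) (Fin n ⊕ Fin n) ℝ,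
      G.map Complex.ofReal = (augCoord n)ᴴ * augMat L P * augCoord n := by
  let v : Fin n ⊕ Fin n → Fin n → ℂ := fun j => realCoord n (Pi.single j 1)
  refine ⟨of fun i j => 2 * ((star (v i) ⬝ᵥ (L *ᵥ v j)).re + (v i ⬝ᵥ (P *ᵥ v j)).re), ?_⟩
  have hcol : ∀ j, (fun i => augCoord n i j) = augVec (v j) := fun j => by
    rw [← augCoord_mulVec]
    ext i
    have : (fun k => (((Pi.single j 1 : Fin n ⊕ Fin n → ℝ) k : ℝ) : ℂ)) = Pi.single j 1 := by
      ext k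
      simp [Pi.single_apply, apply_ite]
    rw [this, mulVec_single_one]
    rfl
  ext i j
  rw [map_apply, of_apply, ← augMat_pairing, ← hcol, ← hcol, mul_assoc]
  rfl

/-- The Gaussian integral of a positive definite weight, up to a dimensional constant. -/
lemma exists_lintegral_exp_neg_weight (n : ℕ) : ∃ c : ℝ≥0∞, c ≠ 0 ∧ c ≠ ⊤ ∧
    ∀ L P : Matrix (Fin n) (Fin n) ℂ, (augMat L P).PosDef →
      ∫⁻ x, ENNReal.ofReal (rexp (-4 * π * weight L P x)) =
        c * ENNReal.ofReal (√(augMat L P).det.re)⁻¹ := by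
  obtain ⟨c, hc0, hct, hc⟩ := exists_lintegral_realCoord n
  set J := ∫⁻ y : Fin n ⊕ Fin n → ℝ, ENNReal.ofReal (rexp (-π * (y ⬝ᵥ y))) with hJ
  have hJt : J ≠ ⊤ := lintegral_exp_neg_dotProduct_self_ne_top
  have hJ0 : J ≠ 0 := by
    rw [hJ, ← pos_iff_ne_zero]
    have hm : Measurable fun y : Fin n ⊕ Fin n → ℝ => ENNReal.ofReal (rexp (-π * (y ⬝ᵥ y))) := by
      unfold dotProduct
      fun_prop
    rw [lintegral_pos_iff_support hm]
    have : Function.support (fun y : Fin n ⊕ Fin n → ℝ =>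
        ENNReal.ofReal (rexp (-π * (y ⬝ᵥ y)))) = Set.univ := by
      ext y
      simp [Real.exp_pos]
    rw [this]
    exact isOpen_univ.measure_pos volume Set.univ_nonempty
  have hW : (augCoord n).det ≠ 0 := by
    have h2 : (-Complex.I • (1 : Matrix (Fin n) (Fin n) ℂ) - Complex.I • 1) =
        (-(2 * Complex.I)) • 1 := by
      rw [← sub_smul]
      congr 1
      ring
    rw [augCoord, det_fromBlocks_one₁₁, one_mul, h2, det_smul, det_one, mul_one]
    exact pow_ne_zero _ (by simp)
  refine ⟨c * (ENNReal.ofReal ‖(augCoord n).det‖⁻¹ * J), ?_, ?_, fun L P h => ?_⟩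
  · simp [hc0, hJ0, hW]
  · exact ENNReal.mul_ne_top hct (ENNReal.mul_ne_top ENNReal.ofReal_ne_top hJt)
  obtain ⟨G, hG⟩ := exists_real_gram L P
  have hquad : ∀ y, y ⬝ᵥ (G *ᵥ y) = 4 * weight L P (realCoord n y) := fun y => by
    apply Complex.ofReal_injective
    rw [← augMat_quadForm, ← augCoord_mulVec, star_mulVec, ← dotProduct_mulVec, mulVec_mulVec,
      mulVec_mulVec, ← hG]
    simp [dotProduct, mulVec]
  have hdet : G.det = ‖(augCoord n).det‖ ^ 2 * (augMat L P).det.re := by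
    have h1 : ((G.det : ℝ) : ℂ) = (G.map Complex.ofReal).det := RingHom.map_det Complex.ofRealHom G
    rw [hG, det_mul, det_mul, det_conjTranspose, mul_right_comm, ← starRingEnd_apply,
      Complex.conj_mul'] at h1
    have := congrArg Complex.re h1
    rw [← Complex.ofReal_pow, Complex.re_ofReal_mul] at this
    exact this
  have hGh : G.IsHermitian := by
    apply Matrix.map_injective Complex.ofReal_injective
    have : (Gᴴ).map Complex.ofReal = (G.map Complex.ofReal)ᴴ := by
      ext; simp
    change (Gᴴ).map Complex.ofReal = G.map Complex.ofReal
    rw [this, hG]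
    exact isHermitian_conjTranspose_mul_mul _ h.1
  have hGpos : G.PosDef := by
    refine PosDef.of_dotProduct_mulVec_pos hGh fun y hy => ?_
    rw [star_trivial, hquad]
    have := weight_pos_of_augMat_posDef h _ ((realCoord n).map_ne_zero_iff.2 hy)
    positivity
  have hmeas : Measurable fun x => ENNReal.ofReal (rexp (-4 * π * weight L P x)) := by
    unfold weight dotC mulVec dotProduct
    fun_prop
  rw [hc _ hmeas]
  have := lintegral_exp_neg_quadForm hGpos
  simp only [hquad] at this
  have he : ∀ w : ℝ, -4 * π * w = -π * (4 * w) := fun w => by ring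
  simp only [he]
  rw [this, hdet, Real.sqrt_mul (by positivity), Real.sqrt_sq (norm_nonneg _), mul_inv,
    ENNReal.ofReal_mul (by positivity)]
  ring

end GaussianIntegral

section CoreInequality

variable {n : ℕ}

lemma augVec_sub (x y : Fin n → ℂ) : augVec (x - y) = augVec x - augVec y := by
  ext i
  rcases i with i | i <;> simp [augVec]

lemma augMat_mulVec_augVec (A B : Matrix (Fin n) (Fin n) ℂ) (x : Fin n → ℂ) :
    augMat A B *ᵥ augVec x = augVec (A *ᵥ x + conjM B *ᵥ star x) := by
  have h : star (conjM B *ᵥ star x) = B *ᵥ x := by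
    rw [conjM_mulVec_star, star_star]
  rw [augMat, augVec, fromBlocks_mulVec, augVec, star_add, h, Sum.elim_comp_inl,
    Sum.elim_comp_inr, conjM_mulVec_star, conjM_mulVec_star, add_comm (B *ᵥ x)]

lemma complete_square {m : Type*} [Fintype m] {M₁ M₂ K : Matrix m m ℂ}
    (hM : M₂.IsHermitian) (hN : (M₂ + K).IsHermitian) {u w : m → ℂ} (v : m → ℂ)
    (hw : (M₂ + K) *ᵥ w = M₂ *ᵥ u) (hu : M₁ *ᵥ u = M₂ *ᵥ (u - w)) :
    star (u - v) ⬝ᵥ (M₂ *ᵥ (u - v)) + star v ⬝ᵥ (K *ᵥ v) =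
      star (v - w) ⬝ᵥ ((M₂ + K) *ᵥ (v - w)) + star u ⬝ᵥ (M₁ *ᵥ u) := by
  have hswap : ∀ {A : Matrix m m ℂ}, A.IsHermitian → ∀ a b : m → ℂ,
      star a ⬝ᵥ (A *ᵥ b) = star (A *ᵥ a) ⬝ᵥ b := fun {A} hA a b => by
    rw [star_mulVec, hA.eq, dotProduct_mulVec]
  have h1 : star w ⬝ᵥ ((M₂ + K) *ᵥ v) = star u ⬝ᵥ (M₂ *ᵥ v) := by
    rw [hswap hN, hw, ← hswap hM]
  have h2 : star u ⬝ᵥ (M₂ *ᵥ w) = star w ⬝ᵥ (M₂ *ᵥ u) := by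
    rw [hswap hM, ← hw, ← hswap hN]
  rw [hu]
  simp only [mulVec_sub, star_sub, sub_dotProduct, dotProduct_sub, h1, h2, hw]
  rw [add_mulVec, dotProduct_add]
  ring

lemma augMat_add (L P L' P' : Matrix (Fin n) (Fin n) ℂ) :
    augMat (L + L') (P + P') = augMat L P + augMat L' P' := by
  rw [augMat, augMat, augMat, fromBlocks_add, conjM_add, conjM_add]

lemma augMat_sub (L P L' P' : Matrix (Fin n) (Fin n) ℂ) :
    augMat (L - L') (P - P') = augMat L P - augMat L' P' := by
  rw [eq_sub_iff_add_eq, ← augMat_add, sub_add_cancel, sub_add_cancel]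

/-- When the pseudo-covariances agree, the first Gaussian weight is obtained from the second one by
convolution with a rotation-invariant Gaussian. -/
lemma exists_completing_square {L₁ P₁ L₂ P₂ : Matrix (Fin n) (Fin n) ℂ}
    (h₁ : (augMat L₁ P₁).PosDef) (h₂ : (augMat L₂ P₂).PosDef)
    (hD : (augMat L₂ P₂ - augMat L₁ P₁).PosDef) (hR : pseudoCovMat L₁ P₁ = pseudoCovMat L₂ P₂) :
    ∃ K : Matrix (Fin n) (Fin n) ℂ, (augMat K 0).PosDef ∧
      ∀ x, ∃ z, ∀ y, weight L₂ P₂ (x - y) + weight K 0 y =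
        weight (L₂ + K) P₂ (y - z) + weight L₁ P₁ x := by
  have hS := posDef_inv_sub_inv h₁ hD
  rw [inv_augMat, inv_augMat, ← augMat_sub, hR, sub_self] at hS
  set D := covMat L₁ P₁ - covMat L₂ P₂ with hDdef
  have hDp : D.PosDef := hS.submatrix Sum.inl_injective
  have hDu : IsUnit D.det := (isUnit_iff_isUnit_det _).1 hDp.isUnit
  have hc0 : conjM (0 : Matrix (Fin n) (Fin n) ℂ) = 0 := by ext; simp [conjM]
  have hKD : augMat D⁻¹ 0 * augMat D 0 = 1 := by
    rw [augMat_mul, hc0, nonsing_inv_mul _ hDu, ← conjM_mul, nonsing_inv_mul _ hDu, conjM_one]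
    simp
  have hK : augMat D⁻¹ 0 = (augMat D 0)⁻¹ := (inv_eq_left_inv hKD).symm
  have hKp : (augMat D⁻¹ 0).PosDef := hK ▸ hS.inv
  have hN : augMat (L₂ + D⁻¹) P₂ = augMat L₂ P₂ + augMat D⁻¹ 0 := by
    rw [← augMat_add, add_zero]
  have hNp : (augMat L₂ P₂ + augMat D⁻¹ 0).PosDef := h₂.add hKp
  refine ⟨D⁻¹, hKp, fun x => ?_⟩
  obtain ⟨z, hz⟩ : ∃ z, augVec z = (augMat (L₂ + D⁻¹) P₂)⁻¹ *ᵥ (augMat L₂ P₂ *ᵥ augVec x) :=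
    ⟨_, by rw [inv_augMat, augMat_mulVec_augVec, augMat_mulVec_augVec]⟩
  refine ⟨z, fun y => ?_⟩
  have hNu := (isUnit_iff_isUnit_det _).1 hNp.isUnit
  have hu₁ := (isUnit_iff_isUnit_det _).1 h₁.isUnit
  have hu₂ := (isUnit_iff_isUnit_det _).1 h₂.isUnit
  have hw : (augMat L₂ P₂ + augMat D⁻¹ 0) *ᵥ augVec z = augMat L₂ P₂ *ᵥ augVec x := by
    rw [hz, mulVec_mulVec, hN, mul_nonsing_inv _ hNu, one_mulVec]
  have hsum : (augMat L₁ P₁)⁻¹ = (augMat L₂ P₂)⁻¹ + augMat D 0 := by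
    rw [inv_augMat, inv_augMat, ← augMat_add, hR, add_zero, hDdef, add_sub_cancel]
  have hu : augMat L₁ P₁ *ᵥ augVec x = augMat L₂ P₂ *ᵥ (augVec x - augVec z) := by
    have hinj := mulVec_injective_of_isUnit h₁.inv.isUnit
    apply hinj
    have hKz : augMat L₂ P₂ *ᵥ (augVec x - augVec z) = augMat D⁻¹ 0 *ᵥ augVec z := by
      rw [mulVec_sub, ← hw, add_mulVec, add_sub_cancel_left]
    rw [mulVec_mulVec, nonsing_inv_mul _ hu₁, one_mulVec, hsum, add_mulVec, mulVec_mulVec,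
      nonsing_inv_mul _ hu₂, one_mulVec, hKz, mulVec_mulVec,
      mul_eq_one_comm.1 hKD, one_mulVec, sub_add_cancel]
  have key := complete_square h₂.1 hNp.1 (augVec y) hw hu
  rw [← hN, ← augVec_sub, ← augVec_sub, augMat_quadForm, augMat_quadForm, augMat_quadForm,
    augMat_quadForm] at key
  have key' : 4 * weight L₂ P₂ (x - y) + 4 * weight D⁻¹ 0 y =
    4 * weight (L₂ + D⁻¹) P₂ (y - z) + 4 * weight L₁ P₁ x := by exact_mod_cast key
  linarith

lemma continuous_weight (L P : Matrix (Fin n) (Fin n) ℂ) : Continuous (weight L P) := by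
  unfold weight dotC mulVec dotProduct
  fun_prop

lemma weight_smul_of_norm_eq_one (K : Matrix (Fin n) (Fin n) ℂ) {a : ℂ} (ha : ‖a‖ = 1)
    (y : Fin n → ℂ) : weight K 0 (a • y) = weight K 0 y := by
  have h : a * (starRingEnd ℂ) a = 1 := by rw [Complex.mul_conj']; simp [ha]
  have : dotC (K.mulVec (a • y)) (star (a • y)) = dotC (K.mulVec y) (star y) := by
    have h2 := dotProduct_smul (starRingEnd ℂ a) (a • (K *ᵥ y)) (star y)
    change (K *ᵥ (a • y)) ⬝ᵥ star (a • y) = (K *ᵥ y) ⬝ᵥ star y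
    rw [mulVec_smul, star_smul, ← starRingEnd_apply, h2, smul_dotProduct, smul_smul, mul_comm, h,
      one_smul]
  rw [weight, weight, this, zero_mulVec, zero_mulVec]
  simp [dotC]

lemma lintegral_smul_of_norm_eq_one {a : ℂ} (ha : ‖a‖ = 1) {g : (Fin n → ℂ) → ℝ≥0∞}
    (hg : Measurable g) : ∫⁻ y, g (a • y) = ∫⁻ y, g y := by
  let c : Circle := ⟨a, mem_sphere_zero_iff_norm.2 ha⟩
  have h : MeasurePreserving (fun y : Fin n → ℂ => fun i => rotation c (y i)) :=
    volume_preserving_pi fun _ => (rotation c).measurePreserving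
  exact h.lintegral_comp hg

/-- The circle mean value inequality along the complex line through `y`. -/
lemma enorm_le_lintegral_circle {g : (Fin n → ℂ) → ℂ} (hg : Differentiable ℂ g)
    (y : Fin n → ℂ) :
    ENNReal.ofReal (2 * π) * ‖g 0‖ₑ ≤
      ∫⁻ θ in Set.Ioc 0 (2 * π), ‖g (circleMap 0 1 θ • y)‖ₑ := by
  have hd : Differentiable ℂ fun z : ℂ => g (z • y) := by fun_prop
  have hmv := DiffContOnCl.circleAverage (c := 0) (R := 1) hd.diffContOnCl
  rw [Real.circleAverage_def, zero_smul, inv_smul_eq_iff₀ (by positivity)] at hmv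
  have h1 : ENNReal.ofReal (2 * π) * ‖g 0‖ₑ = ‖(2 * π) • g 0‖ₑ := by
    rw [enorm_smul, Real.enorm_of_nonneg (by positivity)]
  rw [h1, ← hmv, intervalIntegral.integral_of_le (by positivity)]
  exact enorm_integral_le_lintegral_enorm _

/-- The mean value inequality for a rotation-invariant Gaussian. -/
lemma enorm_mul_lintegral_le {g : (Fin n → ℂ) → ℂ} (hg : Differentiable ℂ g)
    (K : Matrix (Fin n) (Fin n) ℂ) :
    ‖g 0‖ₑ * ∫⁻ y, ENNReal.ofReal (rexp (-4 * π * weight K 0 y)) ≤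
      ∫⁻ y, ‖g y‖ₑ * ENNReal.ofReal (rexp (-4 * π * weight K 0 y)) := by
  have hcw := continuous_weight K 0
  have hcg := hg.continuous
  have hm : Measurable fun y => ENNReal.ofReal (rexp (-4 * π * weight K 0 y)) := by fun_prop
  have hmg : Measurable fun y => ‖g y‖ₑ * ENNReal.ofReal (rexp (-4 * π * weight K 0 y)) :=
    hcg.enorm.measurable.mul hm
  have h2π : ENNReal.ofReal (2 * π) ≠ 0 := by simp [pi_pos]
  refine (ENNReal.mul_le_mul_iff_right h2π ENNReal.ofReal_ne_top).1 ?_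
  calc ENNReal.ofReal (2 * π) *
        (‖g 0‖ₑ * ∫⁻ y, ENNReal.ofReal (rexp (-4 * π * weight K 0 y)))
      = ∫⁻ y, ENNReal.ofReal (2 * π) * ‖g 0‖ₑ *
          ENNReal.ofReal (rexp (-4 * π * weight K 0 y)) := by
        rw [lintegral_const_mul _ hm, mul_assoc]
    _ ≤ ∫⁻ y, ∫⁻ θ in Set.Ioc 0 (2 * π), ‖g (circleMap 0 1 θ • y)‖ₑ *
          ENNReal.ofReal (rexp (-4 * π * weight K 0 y)) := by
        refine lintegral_mono fun y => ?_
        dsimp only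
        have : Measurable fun θ : ℝ => ‖g (circleMap 0 1 θ • y)‖ₑ :=
          (by fun_prop : Continuous fun θ : ℝ => g (circleMap 0 1 θ • y)).enorm.measurable
        rw [lintegral_mul_const _ this]
        gcongr
        exact enorm_le_lintegral_circle hg y
    _ = ∫⁻ θ in Set.Ioc 0 (2 * π), ∫⁻ y, ‖g (circleMap 0 1 θ • y)‖ₑ *
          ENNReal.ofReal (rexp (-4 * π * weight K 0 y)) := by
        refine lintegral_lintegral_swap (Measurable.aemeasurable ?_)
        refine Measurable.mul (f := fun p : (Fin n → ℂ) × ℝ => ‖g (circleMap 0 1 p.2 • p.1)‖ₑ)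
          ?_ (hm.comp measurable_fst)
        exact (by fun_prop : Continuous fun p : (Fin n → ℂ) × ℝ =>
          g (circleMap 0 1 p.2 • p.1)).enorm.measurable
    _ = ∫⁻ _ in Set.Ioc 0 (2 * π), ∫⁻ y, ‖g y‖ₑ *
          ENNReal.ofReal (rexp (-4 * π * weight K 0 y)) := by
        refine lintegral_congr fun θ => ?_
        have ha : ‖circleMap 0 1 θ‖ = 1 := by simp
        rw [← lintegral_smul_of_norm_eq_one ha hmg]
        simp only [weight_smul_of_norm_eq_one K ha]
    _ = _ := by
        rw [setLIntegral_const, Real.volume_Ioc, sub_zero, mul_comm]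

lemma HPhiNormSq_eq (Φ : (Fin n → ℂ) → ℝ) (f : (Fin n → ℂ) → ℂ) :
    HPhiNormSq Φ f = ∫⁻ x, ‖f x ^ 2‖ₑ * ENNReal.ofReal (rexp (-4 * π * Φ x)) := by
  refine lintegral_congr fun x => ?_
  rw [ENNReal.ofReal_mul (by positivity), ← norm_pow, ofReal_norm]

/-- Convolution identity relating the two weighted norms. -/
lemma HPhiNormSq_convolution {L₁ P₁ L₂ P₂ K : Matrix (Fin n) (Fin n) ℂ}
    (hsq : ∀ x, ∃ z, ∀ y, weight L₂ P₂ (x - y) + weight K 0 y =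
        weight (L₂ + K) P₂ (y - z) + weight L₁ P₁ x)
    {f : (Fin n → ℂ) → ℂ} (hf : Continuous f) :
    (∫⁻ y, ENNReal.ofReal (rexp (-4 * π * weight (L₂ + K) P₂ y))) *
        HPhiNormSq (weight L₁ P₁) f =
      ∫⁻ x, (∫⁻ y, ‖f (x + y) ^ 2‖ₑ * ENNReal.ofReal (rexp (-4 * π * weight K 0 y))) *
        ENNReal.ofReal (rexp (-4 * π * weight L₂ P₂ x)) := by
  have hc₁ := continuous_weight L₁ P₁
  have hc₂ := continuous_weight L₂ P₂
  have hcK := continuous_weight K 0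
  have hcN := continuous_weight (L₂ + K) P₂
  have hmE : ∀ {w : (Fin n → ℂ) → ℝ}, Continuous w →
      Measurable fun y => ENNReal.ofReal (rexp (-4 * π * w y)) := fun hw => by fun_prop
  have hmf : Measurable fun x => ‖f x ^ 2‖ₑ := (hf.pow 2).enorm.measurable
  have hmfa : Measurable fun p : (Fin n → ℂ) × (Fin n → ℂ) => ‖f (p.1 + p.2) ^ 2‖ₑ :=
    ((by fun_prop : Continuous fun p : (Fin n → ℂ) × (Fin n → ℂ) =>
      f (p.1 + p.2) ^ 2)).enorm.measurable
  rw [HPhiNormSq_eq, ← lintegral_const_mul _ (hmf.fun_mul (hmE hc₁))]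
  calc ∫⁻ x, (∫⁻ y, ENNReal.ofReal (rexp (-4 * π * weight (L₂ + K) P₂ y))) *
        (‖f x ^ 2‖ₑ * ENNReal.ofReal (rexp (-4 * π * weight L₁ P₁ x)))
      = ∫⁻ x, ∫⁻ y, ‖f x ^ 2‖ₑ * (ENNReal.ofReal (rexp (-4 * π * weight L₂ P₂ (x - y))) *
          ENNReal.ofReal (rexp (-4 * π * weight K 0 y))) := by
        refine lintegral_congr fun x => ?_
        obtain ⟨z, hz⟩ := hsq x
        have hm : Measurable fun y =>
            ENNReal.ofReal (rexp (-4 * π * weight (L₂ + K) P₂ (y - z))) :=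
          (hmE hcN).comp (measurable_id.sub_const z)
        rw [← lintegral_sub_right_eq_self _ z, ← lintegral_mul_const _ hm]
        refine lintegral_congr fun y => ?_
        have : rexp (-4 * π * weight L₂ P₂ (x - y)) * rexp (-4 * π * weight K 0 y) =
            rexp (-4 * π * weight (L₂ + K) P₂ (y - z)) * rexp (-4 * π * weight L₁ P₁ x) := by
          rw [← Real.exp_add, ← Real.exp_add, ← mul_add, ← mul_add, hz]
        rw [← ENNReal.ofReal_mul (exp_nonneg _), this, ENNReal.ofReal_mul (exp_nonneg _)]
        ring
    _ = ∫⁻ y, ∫⁻ x, ‖f x ^ 2‖ₑ * (ENNReal.ofReal (rexp (-4 * π * weight L₂ P₂ (x - y))) *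
          ENNReal.ofReal (rexp (-4 * π * weight K 0 y))) := by
        refine lintegral_lintegral_swap (Measurable.aemeasurable ?_)
        exact (hmf.comp measurable_fst).mul
          (((hmE hc₂).comp (measurable_fst.sub measurable_snd)).mul
            ((hmE hcK).comp measurable_snd))
    _ = ∫⁻ y, ∫⁻ x, ‖f (x + y) ^ 2‖ₑ * (ENNReal.ofReal (rexp (-4 * π * weight L₂ P₂ x)) *
          ENNReal.ofReal (rexp (-4 * π * weight K 0 y))) := by
        refine lintegral_congr fun y => ?_
        rw [← lintegral_add_right_eq_self _ y]
        simp only [add_sub_cancel_right]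
    _ = ∫⁻ x, ∫⁻ y, ‖f (x + y) ^ 2‖ₑ * (ENNReal.ofReal (rexp (-4 * π * weight L₂ P₂ x)) *
          ENNReal.ofReal (rexp (-4 * π * weight K 0 y))) := by
        refine (lintegral_lintegral_swap (Measurable.aemeasurable ?_)).symm
        exact hmfa.mul (((hmE hc₂).comp measurable_fst).mul ((hmE hcK).comp measurable_snd))
    _ = _ := by
        refine lintegral_congr fun x => ?_
        have hm : Measurable fun y => ‖f (x + y) ^ 2‖ₑ :=
          (by fun_prop : Continuous fun y => f (x + y) ^ 2).enorm.measurable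
        rw [← lintegral_mul_const _ (hm.fun_mul (hmE hcK))]
        exact lintegral_congr fun y => by ring

end CoreInequality

section StrictInequality

variable {n : ℕ}

lemma HPhiNormSq_one (Φ : (Fin n → ℂ) → ℝ) :
    HPhiNormSq Φ 1 = ∫⁻ x, ENNReal.ofReal (rexp (-4 * π * Φ x)) := by
  simp [HPhiNormSq]

/-- When the pseudo-covariances agree, constants maximize the norm ratio. -/
lemma HPhiNormSq_mul_le {L₁ P₁ L₂ P₂ : Matrix (Fin n) (Fin n) ℂ}
    (h₁ : (augMat L₁ P₁).PosDef) (h₂ : (augMat L₂ P₂).PosDef)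
    (hD : (augMat L₂ P₂ - augMat L₁ P₁).PosDef) (hR : pseudoCovMat L₁ P₁ = pseudoCovMat L₂ P₂)
    {f : (Fin n → ℂ) → ℂ} (hf : Differentiable ℂ f) :
    HPhiNormSq (weight L₁ P₁) 1 * HPhiNormSq (weight L₂ P₂) f ≤
      HPhiNormSq (weight L₂ P₂) 1 * HPhiNormSq (weight L₁ P₁) f := by
  obtain ⟨K, hK, hsq⟩ := exists_completing_square h₁ h₂ hD hR
  obtain ⟨c, hc0, hct, hc⟩ := exists_lintegral_exp_neg_weight n
  set N := ∫⁻ y, ENNReal.ofReal (rexp (-4 * π * weight K 0 y)) with hN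
  have hdK : 0 < (augMat K 0).det.re := (Complex.lt_def.1 hK.det_pos).1
  have hN0 : N ≠ 0 := by
    rw [hN, hc _ _ hK]
    exact mul_ne_zero hc0 (by simp [hdK])
  have hNt : N ≠ ⊤ := by
    rw [hN, hc _ _ hK]
    exact ENNReal.mul_ne_top hct ENNReal.ofReal_ne_top
  have hmE : Measurable fun x => ENNReal.ofReal (rexp (-4 * π * weight L₂ P₂ x)) := by
    have := continuous_weight L₂ P₂
    fun_prop
  have hle : N * HPhiNormSq (weight L₂ P₂) f ≤
      (∫⁻ y, ENNReal.ofReal (rexp (-4 * π * weight (L₂ + K) P₂ y))) *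
        HPhiNormSq (weight L₁ P₁) f := by
    have hmf : Measurable fun x => ‖f x ^ 2‖ₑ := (hf.continuous.pow 2).enorm.measurable
    rw [HPhiNormSq_convolution hsq hf.continuous, HPhiNormSq_eq,
      ← lintegral_const_mul _ (hmf.fun_mul hmE)]
    refine lintegral_mono fun x => ?_
    dsimp only
    rw [← mul_assoc, mul_comm N]
    gcongr
    have hg : Differentiable ℂ fun y => f (x + y) ^ 2 := by fun_prop
    simpa only [add_zero] using enorm_mul_lintegral_le hg K
  have heq : N * HPhiNormSq (weight L₂ P₂) 1 =
      (∫⁻ y, ENNReal.ofReal (rexp (-4 * π * weight (L₂ + K) P₂ y))) *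
        HPhiNormSq (weight L₁ P₁) 1 := by
    rw [HPhiNormSq_convolution hsq continuous_one, HPhiNormSq_one, ← lintegral_const_mul _ hmE]
    simp [hN]
  refine (ENNReal.mul_le_mul_iff_right hN0 hNt).1 ?_
  rw [mul_left_comm, ← mul_assoc N (HPhiNormSq (weight L₂ P₂) 1), heq]
  calc HPhiNormSq (weight L₁ P₁) 1 * (N * HPhiNormSq (weight L₂ P₂) f)
      ≤ HPhiNormSq (weight L₁ P₁) 1 *
        ((∫⁻ y, ENNReal.ofReal (rexp (-4 * π * weight (L₂ + K) P₂ y))) *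
          HPhiNormSq (weight L₁ P₁) f) := by gcongr
    _ = _ := by ring

/-- Multiplication by a Gaussian shifts the pluriharmonic part of the weight. -/
lemma HPhiNormSq_mul_exp (L P Q : Matrix (Fin n) (Fin n) ℂ) (f : (Fin n → ℂ) → ℂ) :
    HPhiNormSq (weight L (P + Q)) (fun x => f x * Complex.exp (π * dotC (Q.mulVec x) x)) =
      HPhiNormSq (weight L P) f := by
  refine lintegral_congr fun x => ?_
  have h : weight L (P + Q) x = weight L P x + 1 / 2 * (dotC (Q.mulVec x) x).re := by
    have := weight_add L P 0 Q x
    rw [add_zero] at this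
    rw [this]
    simp [weight, dotC]
  rw [norm_mul, Complex.norm_exp, Complex.re_ofReal_mul, mul_pow, ← Real.exp_nat_mul, mul_assoc,
    ← Real.exp_add, h]
  congr 4
  push_cast
  ring

lemma differentiable_dotC_mulVec (Q : Matrix (Fin n) (Fin n) ℂ) :
    Differentiable ℂ fun x => dotC (Q.mulVec x) x := by
  unfold dotC mulVec dotProduct
  fun_prop

lemma HPhiNorm_div (Φ₁ Φ₂ : (Fin n → ℂ) → ℝ) (f : (Fin n → ℂ) → ℂ) :
    HPhiNorm Φ₂ f / HPhiNorm Φ₁ f = (HPhiNormSq Φ₂ f / HPhiNormSq Φ₁ f) ^ (1 / 2 : ℝ) :=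
  (ENNReal.div_rpow_of_nonneg _ _ (by norm_num)).symm

/-- The norm of the embedding is attained at a Gaussian. -/
lemma embedNorm_eq_of_pseudoCovMat_eq {L₁ P₁ L₂ P₂ Q : Matrix (Fin n) (Fin n) ℂ}
    (h₁ : (augMat L₁ (P₁ + Q)).PosDef) (h₂ : (augMat L₂ (P₂ + Q)).PosDef)
    (hD : (augMat L₂ (P₂ + Q) - augMat L₁ (P₁ + Q)).PosDef)
    (hR : pseudoCovMat L₁ (P₁ + Q) = pseudoCovMat L₂ (P₂ + Q)) :
    embedNorm (weight L₁ P₁) (weight L₂ P₂) = ENNReal.ofReal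
      (((augMat L₁ (P₁ + Q)).det.re / (augMat L₂ (P₂ + Q)).det.re) ^ ((1 : ℝ) / 4)) := by
  obtain ⟨c, hc0, hct, hc⟩ := exists_lintegral_exp_neg_weight n
  have hd₁ : 0 < (augMat L₁ (P₁ + Q)).det.re := (Complex.lt_def.1 h₁.det_pos).1
  have hd₂ : 0 < (augMat L₂ (P₂ + Q)).det.re := (Complex.lt_def.1 h₂.det_pos).1
  set G₁ := HPhiNormSq (weight L₁ (P₁ + Q)) 1 with hG₁
  set G₂ := HPhiNormSq (weight L₂ (P₂ + Q)) 1 with hG₂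
  have hG₁' : G₁ = c * ENNReal.ofReal (√(augMat L₁ (P₁ + Q)).det.re)⁻¹ := by
    rw [hG₁, HPhiNormSq_one, hc _ _ h₁]
  have hG₂' : G₂ = c * ENNReal.ofReal (√(augMat L₂ (P₂ + Q)).det.re)⁻¹ := by
    rw [hG₂, HPhiNormSq_one, hc _ _ h₂]
  have hG₁0 : G₁ ≠ 0 := by
    rw [hG₁']
    exact mul_ne_zero hc0 (by simp [hd₁])
  have hG₁t : G₁ ≠ ⊤ := by
    rw [hG₁']
    exact ENNReal.mul_ne_top hct ENNReal.ofReal_ne_top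
  have hratio : (G₂ / G₁) ^ (1 / 2 : ℝ) = ENNReal.ofReal
      (((augMat L₁ (P₁ + Q)).det.re / (augMat L₂ (P₂ + Q)).det.re) ^ ((1 : ℝ) / 4)) := by
    rw [hG₁', hG₂', ENNReal.mul_div_mul_left _ _ hc0 hct,
      ← ENNReal.ofReal_div_of_pos (by positivity), ENNReal.ofReal_rpow_of_nonneg (by positivity)
      (by norm_num)]
    congr 1
    rw [div_inv_eq_mul, mul_comm, ← div_eq_mul_inv, ← Real.sqrt_div hd₁.le, Real.sqrt_eq_rpow,
      ← Real.rpow_mul (by positivity)]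
    norm_num
  have hd : ∀ s : ℂ, Differentiable ℂ fun x => Complex.exp (s * dotC (Q.mulVec x) x) := fun s =>
    ((differentiable_dotC_mulVec Q).const_mul s).cexp
  rw [← hratio]
  apply le_antisymm
  · refine iSup_le fun ⟨f, hf, hf0, hft⟩ => ?_
    rw [HPhiNorm_div]
    refine ENNReal.rpow_le_rpow ?_ (by norm_num)
    have hsq0 : HPhiNormSq (weight L₁ P₁) f ≠ 0 := fun h0 => by
      simp [HPhiNorm, h0] at hf0
    have hsqt : HPhiNormSq (weight L₁ P₁) f ≠ ⊤ := fun h0 => by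
      simp [HPhiNorm, h0] at hft
    have := HPhiNormSq_mul_le h₁ h₂ hD hR (hf.mul (hd π))
    have h3 : ∀ L P, HPhiNormSq (weight L (P + Q))
        (f * fun x => Complex.exp (π * dotC (Q.mulVec x) x)) = HPhiNormSq (weight L P) f :=
      fun L P => HPhiNormSq_mul_exp L P Q f
    rw [h3, h3] at this
    rw [ENNReal.div_le_iff hsq0 hsqt, ← ENNReal.mul_div_right_comm,
      ENNReal.le_div_iff_mul_le (Or.inl hG₁0) (Or.inl hG₁t), mul_comm]
    exact this
  · have hval : ∀ L P, HPhiNormSq (weight L P)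
        (fun x => Complex.exp (-π * dotC (Q.mulVec x) x)) =
          HPhiNormSq (weight L (P + Q)) 1 := fun L P => by
      rw [← HPhiNormSq_mul_exp L P Q]
      congr 1
      ext x
      rw [← Complex.exp_add]
      simp
    have hpos : 0 < HPhiNorm (weight L₁ P₁) fun x => Complex.exp (-π * dotC (Q.mulVec x) x) := by
      rw [HPhiNorm, hval]
      exact ENNReal.rpow_pos (pos_iff_ne_zero.2 hG₁0) hG₁t
    have hfin : HPhiNorm (weight L₁ P₁) (fun x => Complex.exp (-π * dotC (Q.mulVec x) x)) ≠ ⊤ := by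
      rw [HPhiNorm, hval]
      exact ENNReal.rpow_ne_top_of_nonneg (by norm_num) hG₁t
    refine le_iSup_of_le ⟨_, hd (-π), hpos, hfin⟩ ?_
    rw [HPhiNorm_div]
    dsimp only
    rw [hval, hval]

/-- The theorem when the weights are strictly ordered away from the origin. -/
lemma embedNorm_of_lt {L₁ P₁ L₂ P₂ : Matrix (Fin n) (Fin n) ℂ}
    (hL₁ : L₁.PosDef) (hL₂ : L₂.PosDef) (hP₁ : P₁.IsSymm) (hP₂ : P₂.IsSymm)
    (hlt : ∀ x, x ≠ 0 → weight L₁ P₁ x < weight L₂ P₂ x) :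
    ∃ ν : Fin n → ℝ, (∀ j, ν j ∈ Set.Ioc (0 : ℝ) 1) ∧
      ((Amat L₂ P₂)⁻¹ * Amat L₁ P₁).charpoly =
        (∏ j, (Polynomial.X - Polynomial.C (ν j : ℂ))) *
          ∏ j, (Polynomial.X - Polynomial.C ((ν j : ℂ)⁻¹)) ∧
      embedNorm (weight L₁ P₁) (weight L₂ P₂) =
        ENNReal.ofReal ((L₁.det.re / L₂.det.re * ∏ j, ν j) ^ ((1 : ℝ) / 4)) := by
  obtain ⟨Q, -, h₁, h₂, hR⟩ := exists_pseudoCovMat_eq hL₁ hL₂ hP₁ hP₂ hlt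
  have hD : (augMat L₂ (P₂ + Q) - augMat L₁ (P₁ + Q)).PosDef := by
    rw [← augMat_sub, add_sub_add_right_eq_sub]
    refine augMat_posDef (hL₂.1.sub hL₁.1) (hP₂.sub hP₁) fun x hx => ?_
    have h3 := weight_add L₁ P₁ (L₂ - L₁) (P₂ - P₁) x
    rw [add_sub_cancel, add_sub_cancel] at h3
    linarith [hlt x hx]
  have hS : (covMat L₁ (P₁ + Q) - covMat L₂ (P₂ + Q)).PosDef :=
    (posDef_inv_sub_inv h₁ hD).submatrix Sum.inl_injective
  have hc₁ := covMat_posDef h₁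
  have hc₂ := covMat_posDef h₂
  obtain ⟨ν, hν, hdet, hp₁, hp₂⟩ := exists_relative_spectrum hc₁ hc₂ hS
  refine ⟨ν, hν, ?_, ?_⟩
  · rw [charpoly_Amat_inv_mul hL₁ hL₂ h₁ h₂ hR, hp₁, hp₂]
  rw [embedNorm_eq_of_pseudoCovMat_eq h₁ h₂ hD hR]
  congr 2
  have him : ∀ {m : Type} [Fintype m] [DecidableEq m] {M : Matrix m m ℂ}, M.PosDef →
      0 < M.det.re ∧ M.det.im = 0 := fun hM =>
    ⟨(Complex.lt_def.1 hM.det_pos).1, (Complex.lt_def.1 hM.det_pos).2.symm⟩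
  have e₁ := congrArg Complex.re (det_augMat_mul_det_covMat hL₁.1 h₁)
  have e₂ := congrArg Complex.re (det_augMat_mul_det_covMat hL₂.1 h₂)
  have e₃ := congrArg Complex.re hdet
  rw [Complex.mul_re, (him h₁).2, zero_mul, sub_zero] at e₁
  rw [Complex.mul_re, (him h₂).2, zero_mul, sub_zero] at e₂
  rw [Complex.re_mul_ofReal] at e₃
  have p₁ := (him h₁).1
  have p₂ := (him h₂).1
  have p₃ := (him hc₁).1
  have p₄ : 0 < ∏ j, ν j := Finset.prod_pos fun j _ => (hν j).1
  rw [← e₁, ← e₂, e₃]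
  field_simp

end StrictInequality

section Limit

variable {n : ℕ}

open Filter Topology

lemma tendsto_matrix_inv {α m : Type*} [Fintype m] [DecidableEq m] {l : Filter α}
    {M : α → Matrix m m ℂ} {A : Matrix m m ℂ} (h : Tendsto M l (𝓝 A)) (hA : IsUnit A) :
    Tendsto (fun a => (M a)⁻¹) l (𝓝 A⁻¹) := by
  have hd : A.det ≠ 0 := ((isUnit_iff_isUnit_det _).1 hA).ne_zero
  simp only [inv_def, Ring.inverse_eq_inv']
  exact (((continuous_id.matrix_det.tendsto A).comp h).inv₀ hd).smul
    ((continuous_id.matrix_adjugate.tendsto A).comp h)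

lemma tendsto_Amat {α : Type*} {l : Filter α} {M : α → Matrix (Fin n) (Fin n) ℂ}
    {L : Matrix (Fin n) (Fin n) ℂ} (h : Tendsto M l (𝓝 L)) (hL : IsUnit L)
    (P : Matrix (Fin n) (Fin n) ℂ) : Tendsto (fun a => Amat (M a) P) l (𝓝 (Amat L P)) := by
  have hconj : Continuous fun X : Matrix (Fin n) (Fin n) ℂ => conjM X :=
    Continuous.matrix_map continuous_id Complex.continuous_conj
  have hblocks : Continuous fun X : (Matrix (Fin n) (Fin n) ℂ × Matrix (Fin n) (Fin n) ℂ) ×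
      (Matrix (Fin n) (Fin n) ℂ × Matrix (Fin n) (Fin n) ℂ) =>
        fromBlocks X.1.1 X.1.2 X.2.1 X.2.2 :=
    continuous_fst.fst.matrix_fromBlocks continuous_fst.snd continuous_snd.fst continuous_snd.snd
  have hinv := tendsto_matrix_inv h hL
  have h2 : Tendsto (fun a => conjM (M a)⁻¹) l (𝓝 (conjM L⁻¹)) := (hconj.tendsto _).comp hinv
  have h3 : Tendsto (fun a => conjM (P * (M a)⁻¹)) l (𝓝 (conjM (P * L⁻¹))) :=
    (hconj.tendsto _).comp (hinv.const_mul P)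
  exact (hblocks.tendsto ((-(conjM L⁻¹ * P), Complex.I • conjM L⁻¹),
      (Complex.I • (L - conjM (P * L⁻¹) * P), -(conjM (P * L⁻¹))))).comp
    (((h2.mul_const P).neg.prodMk_nhds (h2.const_smul Complex.I)).prodMk_nhds
      (((h.sub (h3.mul_const P)).const_smul Complex.I).prodMk_nhds h3.neg))

lemma weight_smul_one (ε : ℝ) (x : Fin n → ℂ) :
    weight ((ε : ℂ) • 1) 0 x = 1 / 2 * (ε * ∑ j, ‖x j‖ ^ 2) := by
  have h : dotC (((ε : ℂ) • (1 : Matrix (Fin n) (Fin n) ℂ)) *ᵥ x) (star x) =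
      ((ε * ∑ j, ‖x j‖ ^ 2 : ℝ) : ℂ) := by
    rw [smul_mulVec, one_mulVec]
    simp [dotC, mul_assoc, Complex.mul_conj', Finset.mul_sum]
  rw [weight, h, zero_mulVec, Complex.ofReal_re]
  simp [dotC]

/-- The product of the small eigenvalues is determined by the spectrum. -/
lemma prod_eq_of_multiset_eq {μ ν : Fin n → ℝ} (hμ : ∀ j, μ j ∈ Set.Ioc (0 : ℝ) 1)
    (hν : ∀ j, ν j ∈ Set.Ioc (0 : ℝ) 1)
    (h : Finset.univ.val.map (fun j => (ν j : ℂ)) + Finset.univ.val.map (fun j => (ν j : ℂ)⁻¹) =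
      Finset.univ.val.map (fun j => (μ j : ℂ)) + Finset.univ.val.map (fun j => (μ j : ℂ)⁻¹)) :
    ∏ j, ν j = ∏ j, μ j := by
  let g : ℂ → ℂ := fun z => if ‖z‖ ≤ 1 then z else 1
  have key : ∀ μ : Fin n → ℝ, (∀ j, μ j ∈ Set.Ioc (0 : ℝ) 1) →
      (((Finset.univ.val.map (fun j => (μ j : ℂ)) +
        Finset.univ.val.map (fun j => (μ j : ℂ)⁻¹))).map g).prod = ((∏ j, μ j : ℝ) : ℂ) := by
    intro μ hμ
    have h1 : ∀ j, g (μ j) = μ j := fun j => by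
      have : ‖(μ j : ℂ)‖ ≤ 1 := by
        rw [Complex.norm_real, Real.norm_of_nonneg (hμ j).1.le]
        exact (hμ j).2
      simp only [g, if_pos this]
    have h2 : ∀ j, g (μ j : ℂ)⁻¹ = 1 := fun j => by
      by_cases hle : ‖((μ j : ℂ)⁻¹)‖ ≤ 1
      · rw [norm_inv, Complex.norm_real, Real.norm_of_nonneg (hμ j).1.le,
          inv_le_one₀ (hμ j).1] at hle
        have : μ j = 1 := le_antisymm (hμ j).2 hle
        simp [g, this]
      · simp only [g, if_neg hle]
    rw [Multiset.map_add, Multiset.map_map, Multiset.map_map, Multiset.prod_add]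
    simp only [Function.comp_def, h1, h2]
    rw [Multiset.map_const', Multiset.prod_replicate, one_pow, mul_one, Complex.ofReal_prod]
    rfl
  have := key ν hν
  rw [h, key μ hμ] at this
  exact_mod_cast this.symm

/-- A limit of polynomials with roots `ν j` and `(ν j)⁻¹` in `(0, 1]` has the same form. -/
lemma charpoly_of_tendsto {p : ℕ → Polynomial ℂ} {q : Polynomial ℂ} {ν : ℕ → Fin n → ℝ}
    {ν₀ : Fin n → ℝ} (hν : ∀ k j, ν k j ∈ Set.Ioc (0 : ℝ) 1)
    (hp : ∀ k, p k = (∏ j, (Polynomial.X - Polynomial.C (ν k j : ℂ))) *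
      ∏ j, (Polynomial.X - Polynomial.C ((ν k j : ℂ)⁻¹)))
    (hq : ∀ t, Tendsto (fun k => (p k).eval t) atTop (𝓝 (q.eval t)))
    (hlim : Tendsto ν atTop (𝓝 ν₀)) :
    (∀ j, ν₀ j ∈ Set.Ioc (0 : ℝ) 1) ∧
      q = (∏ j, (Polynomial.X - Polynomial.C (ν₀ j : ℂ))) *
        ∏ j, (Polynomial.X - Polynomial.C ((ν₀ j : ℂ)⁻¹)) := by
  have hlimj : ∀ j, Tendsto (fun k => ν k j) atTop (𝓝 (ν₀ j)) := fun j =>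
    (tendsto_pi_nhds.1 hlim) j
  have hlimc : ∀ j, Tendsto (fun k => (ν k j : ℂ)) atTop (𝓝 (ν₀ j : ℂ)) := fun j =>
    (Complex.continuous_ofReal.tendsto _).comp (hlimj j)
  have hinv : ∀ (ν : Fin n → ℝ) (t : ℂ), (∀ j, ν j ≠ 0) →
      (∏ j, (t - (ν j : ℂ)⁻¹)) * ∏ j, (ν j : ℂ) = ∏ j, (ν j * t - 1) := fun ν t h => by
    rw [← Finset.prod_mul_distrib]
    refine Finset.prod_congr rfl fun j _ => ?_
    have : (ν j : ℂ) ≠ 0 := Complex.ofReal_ne_zero.2 (h j)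
    field_simp
  have heval : ∀ (ν : Fin n → ℝ) (t : ℂ),
      ((∏ j, (Polynomial.X - Polynomial.C (ν j : ℂ))) *
        ∏ j, (Polynomial.X - Polynomial.C ((ν j : ℂ)⁻¹))).eval t =
        (∏ j, (t - (ν j : ℂ))) * ∏ j, (t - (ν j : ℂ)⁻¹) := fun ν t => by
    simp [Polynomial.eval_prod]
  have key : ∀ t, q.eval t * ∏ j, (ν₀ j : ℂ) =
      (∏ j, (t - (ν₀ j : ℂ))) * ∏ j, (ν₀ j * t - 1) := fun t => by
    refine tendsto_nhds_unique ((hq t).mul (tendsto_finsetProd _ fun j _ => hlimc j)) ?_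
    have : ∀ k, (p k).eval t * ∏ j, (ν k j : ℂ) =
        (∏ j, (t - (ν k j : ℂ))) * ∏ j, (ν k j * t - 1) := fun k => by
      rw [hp, heval, mul_assoc, hinv _ _ fun j => (hν k j).1.ne']
    simp only [this]
    exact (tendsto_finsetProd _ fun j _ => (hlimc j).const_sub t).mul
      (tendsto_finsetProd _ fun j _ => ((hlimc j).mul_const t).sub_const 1)
  have hge : ∀ j, 0 ≤ ν₀ j := fun j => ge_of_tendsto' (hlimj j) fun k => (hν k j).1.le
  have hle : ∀ j, ν₀ j ≤ 1 := fun j => le_of_tendsto' (hlimj j) fun k => (hν k j).2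
  have hne : ∏ j, (ν₀ j : ℂ) ≠ 0 := by
    intro h0
    have h1 := key (-1)
    rw [h0, mul_zero, eq_comm, mul_eq_zero, Finset.prod_eq_zero_iff, Finset.prod_eq_zero_iff] at h1
    rcases h1 with ⟨j, -, hj⟩ | ⟨j, -, hj⟩
    · have := congrArg Complex.re hj
      simp at this
      linarith [hge j]
    · have := congrArg Complex.re hj
      simp at this
      linarith [hge j]
  have hne' : ∀ j, ν₀ j ≠ 0 := fun j =>
    Complex.ofReal_ne_zero.1 (Finset.prod_ne_zero_iff.1 hne j (Finset.mem_univ j))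
  refine ⟨fun j => ⟨(hge j).lt_of_ne' (hne' j), hle j⟩, Polynomial.funext fun t => ?_⟩
  refine mul_right_cancel₀ hne ?_
  rw [key, heval, mul_assoc, hinv _ _ hne']

lemma HPhiNorm_anti {Φ Φ' : (Fin n → ℂ) → ℝ} (h : ∀ x, Φ x ≤ Φ' x) (f : (Fin n → ℂ) → ℂ) :
    HPhiNorm Φ' f ≤ HPhiNorm Φ f := by
  refine ENNReal.rpow_le_rpow (lintegral_mono fun x => ?_) (by norm_num)
  refine ENNReal.ofReal_le_ofReal (mul_le_mul_of_nonneg_left (Real.exp_le_exp.2 ?_) (by positivity))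
  nlinarith [h x, pi_pos]

/-- Monotone convergence of the norms for a decreasing sequence of weights. -/
lemma tendsto_HPhiNorm {Φ : (Fin n → ℂ) → ℝ} {Ψ : ℕ → (Fin n → ℂ) → ℝ}
    (hΨ : ∀ k, Continuous (Ψ k)) (hanti : ∀ x, Antitone fun k => Ψ k x)
    (hlim : ∀ x, Tendsto (fun k => Ψ k x) atTop (𝓝 (Φ x)))
    {f : (Fin n → ℂ) → ℂ} (hf : Continuous f) :
    Tendsto (fun k => HPhiNorm (Ψ k) f) atTop (𝓝 (HPhiNorm Φ f)) := by
  refine Tendsto.ennrpow_const _ ?_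
  refine lintegral_tendsto_of_tendsto_of_monotone (fun k => ?_) (ae_of_all _ fun x => ?_)
    (ae_of_all _ fun x => ?_)
  · have := hΨ k
    exact Measurable.aemeasurable (by fun_prop)
  · intro k l hkl
    have := hanti x hkl
    refine ENNReal.ofReal_le_ofReal
      (mul_le_mul_of_nonneg_left (Real.exp_le_exp.2 ?_) (by positivity))
    nlinarith [pi_pos]
  · exact (ENNReal.continuous_ofReal.tendsto _).comp
      (((Real.continuous_exp.tendsto _).comp ((hlim x).const_mul _)).const_mul _)

end Limit

/-- the norm of the embedding ι : H_{Φ₁} → H_{Φ₂}. -/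
theorem embedding_norm (n : ℕ) (L₁ P₁ L₂ P₂ : Matrix (Fin n) (Fin n) ℂ)
    (hL₁ : L₁.PosDef) (hL₂ : L₂.PosDef) (hP₁ : P₁.IsSymm) (hP₂ : P₂.IsSymm)
    (hle : ∀ x, weight L₁ P₁ x ≤ weight L₂ P₂ x)
    (μ : Fin n → ℝ) (hμ : ∀ j, μ j ∈ Set.Ioc (0 : ℝ) 1)
    (hroots : ((Amat L₂ P₂)⁻¹ * Amat L₁ P₁).charpoly.roots =
        Finset.univ.val.map (fun j => (μ j : ℂ)) +
          Finset.univ.val.map (fun j => ((μ j : ℂ))⁻¹)) :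
    embedNorm (weight L₁ P₁) (weight L₂ P₂) =
      ENNReal.ofReal ((L₁.det.re / L₂.det.re * ∏ j, μ j) ^ ((1 : ℝ) / 4)) := by
  let ε : ℕ → ℝ := fun k => 1 / ((k : ℝ) + 1)
  have hεpos : ∀ k, 0 < ε k := fun k => by positivity
  have hε : Filter.Tendsto ε Filter.atTop (nhds 0) := tendsto_one_div_add_atTop_nhds_zero_nat
  have hεanti : Antitone ε := fun k l hkl => one_div_le_one_div_of_le (by positivity)
    (by gcongr)
  let M : ℕ → Matrix (Fin n) (Fin n) ℂ := fun k => L₂ + ((ε k : ℝ) : ℂ) • 1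
  have hM : ∀ k, (M k).PosDef := fun k =>
    hL₂.add (PosDef.one.smul (by exact_mod_cast hεpos k))
  have hMlim : Filter.Tendsto M Filter.atTop (nhds L₂) := by
    have h0 : Filter.Tendsto (fun k => ((ε k : ℝ) : ℂ)) Filter.atTop (nhds 0) := by
      exact_mod_cast (Complex.continuous_ofReal.tendsto 0).comp hε
    have h1 := (h0.smul_const (1 : Matrix (Fin n) (Fin n) ℂ)).const_add L₂
    rwa [zero_smul, add_zero] at h1
  have hw : ∀ k x, weight (M k) P₂ x =
      weight L₂ P₂ x + 1 / 2 * (ε k * ∑ j, ‖x j‖ ^ 2) := fun k x => by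
    rw [← weight_smul_one, ← weight_add, add_zero]
  have hge : ∀ k x, weight L₂ P₂ x ≤ weight (M k) P₂ x := fun k x => by
    rw [hw]
    have := (hεpos k).le
    have : 0 ≤ 1 / 2 * (ε k * ∑ j, ‖x j‖ ^ 2) := by positivity
    linarith
  have hlt : ∀ k x, x ≠ 0 → weight L₁ P₁ x < weight (M k) P₂ x := fun k x hx => by
    obtain ⟨j, hj⟩ := Function.ne_iff.1 hx
    have hs : 0 < ∑ j, ‖x j‖ ^ 2 := Finset.sum_pos' (fun _ _ => by positivity)
      ⟨j, Finset.mem_univ j, pow_pos (norm_pos_iff.2 hj) 2⟩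
    have := mul_pos (hεpos k) hs
    rw [hw]
    linarith [hle x]
  choose ν hν hchar hnorm using fun k => embedNorm_of_lt hL₁ (hM k) hP₁ hP₂ (hlt k)
  obtain ⟨ν₀, -, φ, hφ, hlim⟩ :=
    (isCompact_univ_pi fun _ : Fin n => isCompact_Icc (a := (0 : ℝ)) (b := 1)).tendsto_subseq
      (x := ν) fun k j _ => Set.Ioc_subset_Icc_self (hν k j)
  have hAlim : Filter.Tendsto (fun k => (Amat (M k) P₂)⁻¹ * Amat L₁ P₁) Filter.atTop
      (nhds ((Amat L₂ P₂)⁻¹ * Amat L₁ P₁)) :=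
    (tendsto_matrix_inv (tendsto_Amat hMlim hL₂.isUnit P₂) (isUnit_Amat hL₂)).mul_const _
  have heval : ∀ t : ℂ, Filter.Tendsto
      (fun k => ((Amat (M k) P₂)⁻¹ * Amat L₁ P₁).charpoly.eval t) Filter.atTop
      (nhds (((Amat L₂ P₂)⁻¹ * Amat L₁ P₁).charpoly.eval t)) := fun t => by
    simp only [Matrix.eval_charpoly]
    exact (continuous_id.matrix_det.tendsto _).comp (hAlim.const_sub _)
  obtain ⟨hν₀, hq⟩ := charpoly_of_tendsto (fun k => hν (φ k)) (fun k => hchar (φ k))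
    (fun t => (heval t).comp hφ.tendsto_atTop) hlim
  have hprod : ∏ j, ν₀ j = ∏ j, μ j := by
    refine prod_eq_of_multiset_eq hμ hν₀ ?_
    have hne : ∀ r : Fin n → ℂ, ∏ j, (Polynomial.X - Polynomial.C (r j)) ≠ 0 := fun r =>
      Finset.prod_ne_zero_iff.2 fun j _ => Polynomial.X_sub_C_ne_zero _
    have hrt : ∀ r : Fin n → ℂ, (∏ j, (Polynomial.X - Polynomial.C (r j))).roots =
        Finset.univ.val.map r := fun r => by
      rw [Polynomial.roots_prod _ _ (hne r)]
      simp [Multiset.bind_singleton]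
    rw [← hroots, hq, Polynomial.roots_mul (mul_ne_zero (hne _) (hne _)), hrt, hrt]
  have hdet : Filter.Tendsto (fun k => (M k).det.re) Filter.atTop (nhds L₂.det.re) :=
    (Complex.continuous_re.tendsto _).comp ((continuous_id.matrix_det.tendsto _).comp hMlim)
  have hdet₂ : L₂.det.re ≠ 0 := (Complex.pos_iff.1 hL₂.det_pos).1.ne'
  have hR : Filter.Tendsto (fun k => embedNorm (weight L₁ P₁) (weight (M (φ k)) P₂)) Filter.atTop
      (nhds (ENNReal.ofReal ((L₁.det.re / L₂.det.re * ∏ j, μ j) ^ ((1 : ℝ) / 4)))) := by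
    simp only [hnorm, ← hprod]
    refine (ENNReal.continuous_ofReal.tendsto _).comp (Filter.Tendsto.rpow_const ?_ (.inr ?_))
    · exact (tendsto_const_nhds.div (hdet.comp hφ.tendsto_atTop) hdet₂).mul
        (tendsto_finsetProd _ fun j _ => tendsto_pi_nhds.1 hlim j)
    · norm_num
  refine le_antisymm (iSup_le fun f => ?_) (le_of_tendsto' hR fun k => ?_)
  · have hf : Filter.Tendsto (fun k => HPhiNorm (weight (M k) P₂) f.1) Filter.atTop
        (nhds (HPhiNorm (weight L₂ P₂) f.1)) := by
      refine tendsto_HPhiNorm (fun k => continuous_weight _ _) (fun x k l hkl => ?_) (fun x => ?_)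
        f.2.1.continuous
      · simp only [hw]
        have := hεanti hkl
        gcongr
      · simp only [hw]
        have := ((hε.mul_const (∑ j, ‖x j‖ ^ 2)).const_mul (1 / 2)).const_add (weight L₂ P₂ x)
        simpa using this
    refine le_of_tendsto_of_tendsto'
      (ENNReal.Tendsto.div_const (hf.comp hφ.tendsto_atTop) (.inr f.2.2.1.ne')) hR fun k => ?_
    exact le_iSup (fun f : {f : (Fin n → ℂ) → ℂ // Differentiable ℂ f ∧
      0 < HPhiNorm (weight L₁ P₁) f ∧ HPhiNorm (weight L₁ P₁) f ≠ ⊤} =>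
        HPhiNorm (weight (M (φ k)) P₂) f.1 / HPhiNorm (weight L₁ P₁) f.1) f
  · exact iSup_mono fun f => ENNReal.div_le_div_right (HPhiNorm_anti (hge _) _) _

end
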